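/- arXiv:math/0512382 — 7 statements merged into one kernel-verified Lean document; each statement's English description precedes it below -/
import Mathlib

section
/- Let $(S_0, S_1, \dots)$ be a supermartingale relative to a filtration $(H_{\le 0} \subseteq H_{\le 1} \subseteq \dots)$ with $S_0 \le 0$ almost surely, and let $X_i := S_i - S_{i-1}$. Suppose that for every $i = 1, \dots, n$ there exist $H_{\le(i-1)}$-measurable random variables $C_{i-1}, D_{i-1}$ and a real number $s_i > 0$ such that $C_{i-1} \le X_i \le D_{i-1}$ and $D_{i-1} - C_{i-1} \le 2 s_i$ almost surely. Then for every real $t$, $\mathsf{E}\,\max(0, S_n - t)^5 \le \mathsf{E}\,\max(0, sZ - t)^5$, where $s := \sqrt{s_1^2 + \dots + s_n^2}$ and $Z$ is a standard normal random variable. -/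
open MeasureTheory ProbabilityTheory Real

lemma mul_pow_five_le (a p : ℝ) (ha : 0 ≤ a) (hp : 2 * p ≤ a) :
    p * (a - 2 * p) ^ 5 ≤ 3125 / 93312 * a ^ 6 := by
  obtain ⟨y, rfl⟩ : ∃ y, p = (a - y) / 2 := ⟨a - 2 * p, by ring⟩
  have hy : 0 ≤ y := by linarith
  have h : 0 ≤ (y - 5 * a / 6) ^ 2 *
      (y ^ 4 + 2 / 3 * y ^ 3 * a + 5 / 12 * y ^ 2 * a ^ 2 + 25 / 108 * y * a ^ 3
        + 125 / 1296 * a ^ 4) := by positivity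
  nlinarith [h]

lemma sqrt_two_pi_bounds : 2.506 ≤ √(2 * π) ∧ √(2 * π) ≤ 2.507 := by
  constructor
  · apply Real.le_sqrt_of_sq_le
    nlinarith [Real.pi_gt_d4]
  · rw [Real.sqrt_le_left (by norm_num)]
    nlinarith [Real.pi_lt_d4]

lemma pow_six_le_gaussian_bound (x : ℝ) (h1 : -2 ≤ x) (h2 : x ≤ 2 / 5) :
    3125 / 93312 * (2 + x) ^ 6 ≤
      8 / √(2 * π) * exp (15 / 16 * √(2 * π) * x - x ^ 2 / 2) := by
  obtain ⟨hr1, hr2⟩ := sqrt_two_pi_bounds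
  generalize √(2 * π) = r at *
  have hA : 3.19 ≤ 8 / r := by
    rw [le_div_iff₀ (by linarith)]; linarith
  have key : ∀ (b e c : ℝ), (2 + x) ≤ c * exp b → 0 ≤ c →
      6 * b - (15 / 16 * r * x - x ^ 2 / 2) ≤ e →
      3125 / 93312 * c ^ 6 * exp e ≤ 3.19 →
      3125 / 93312 * (2 + x) ^ 6 ≤ 8 / r * exp (15 / 16 * r * x - x ^ 2 / 2) := by
    intro b e c hb hc he h
    calc 3125 / 93312 * (2 + x) ^ 6 ≤ 3125 / 93312 * (c * exp b) ^ 6 := by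
          have : 0 ≤ 2 + x := by linarith
          gcongr
      _ = 3125 / 93312 * c ^ 6 * exp (6 * b) := by
          rw [mul_pow, ← Real.exp_nat_mul]; push_cast; ring
      _ ≤ 3125 / 93312 * c ^ 6 * exp (e + (15 / 16 * r * x - x ^ 2 / 2)) := by
          have : 6 * b ≤ e + (15 / 16 * r * x - x ^ 2 / 2) := by linarith
          gcongr
      _ = 3125 / 93312 * c ^ 6 * exp e * exp (15 / 16 * r * x - x ^ 2 / 2) := by
          rw [Real.exp_add]; ring
      _ ≤ _ := by gcongr; exact h.trans hA
  rcases le_total x (-1) with h | h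
  · refine key (1 + x) 3 1 (by linarith [Real.add_one_le_exp (1 + x)]) (by norm_num) ?_ ?_
    · nlinarith
    · have : exp 3 = exp 1 ^ 3 := by rw [← Real.exp_nat_mul]; norm_num
      rw [this]
      have h3 : exp 1 ^ 3 ≤ 2.72 ^ 3 := by
        gcongr
        linarith [Real.exp_one_lt_d9]
      norm_num at h3 ⊢
      linarith
  · refine key (x / 2) 0.35 2 (by linarith [Real.add_one_le_exp (x / 2)]) (by norm_num) ?_ ?_
    · rcases le_total x 0 with h0 | h0
      · nlinarith
      · nlinarith
    · have e1 : exp 0.35 * (exp (-0.175)) ^ 2 = 1 := by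
        rw [← Real.exp_nat_mul, ← Real.exp_add]; norm_num
      have e2 : 0.825 ^ 2 ≤ (exp (-0.175)) ^ 2 := by
        gcongr
        linarith [Real.add_one_le_exp (-0.175)]
      have e3 := Real.exp_pos 0.35
      have e4 : exp 0.35 * 0.825 ^ 2 ≤ 1 := by
        rw [← e1]; gcongr
      norm_num at e4 ⊢
      linarith

lemma le_gaussian_tail_bound (x : ℝ) (h1 : 0 ≤ x) (h2 : x ≤ 1 / 2) :
    x ≤ 8 / √(2 * π) * exp (15 / 16 * √(2 * π) * (-x) - (-x) ^ 2 / 2) := by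
  obtain ⟨hr1, hr2⟩ := sqrt_two_pi_bounds
  generalize √(2 * π) = r at *
  have hA : 3.19 ≤ 8 / r := by
    rw [le_div_iff₀ (by linarith)]; linarith
  have h3 : -1.304 ≤ 15 / 16 * r * (-x) - (-x) ^ 2 / 2 := by nlinarith
  have e1 : exp (-1.304) = (exp (-0.326)) ^ 4 := by
    rw [← Real.exp_nat_mul]; norm_num
  have e2 : 0.674 ^ 4 ≤ (exp (-0.326)) ^ 4 := by
    gcongr
    linarith [Real.add_one_le_exp (-0.326)]
  calc x ≤ 3.19 * 0.674 ^ 4 := by norm_num; linarith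
    _ ≤ 8 / r * exp (-1.304) := by rw [e1]; gcongr
    _ ≤ _ := by gcongr

lemma add_mul_two_sub_pow_five_le (x y : ℝ) (hx : 2 / 5 ≤ x) (hy0 : 0 ≤ y) (hy2 : y ≤ 2) :
    (x + y) * (2 - y) ^ 5 ≤ 32 * x := by
  have hb : (1 - y / 2) ^ 5 * (1 + y / 2) ^ 5 ≤ 1 := by
    rw [← mul_pow]
    apply pow_le_one₀
    · nlinarith
    · nlinarith
  have hc : 1 + 5 * (y / 2) ≤ (1 + y / 2) ^ 5 := by
    have := one_add_mul_le_pow (show (-2 : ℝ) ≤ y / 2 by linarith) 5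
    push_cast at this
    linarith
  have hd : 0 ≤ (1 - y / 2) ^ 5 := by
    have : 0 ≤ 1 - y / 2 := by linarith
    positivity
  have he : (1 - y / 2) ^ 5 * (1 + 5 * (y / 2)) ≤ 1 := by nlinarith
  have hf : x + y ≤ x * (1 + 5 * (y / 2)) := by nlinarith
  have hg : (1 - y / 2) ^ 5 * (x + y) ≤ x := by nlinarith
  have hh : (2 - y) ^ 5 = 32 * (1 - y / 2) ^ 5 := by ring
  rw [hh]; linarith

lemma quintic_defect_nonneg (x u : ℝ) (hx : 1 / 2 ≤ x) (hu0 : 0 ≤ u) (hu1 : u ≤ 1) :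
    0 ≤ 10 * x * (x * u - (1 - u ^ 2)) ^ 2 + 5 * x * u ^ 2 * (2 + u ^ 2)
      - 4 * u * (1 - u ^ 4) := by
  have hv : 0 ≤ 1 - u ^ 2 := by nlinarith
  rcases le_total (8 / 15 * (1 - u ^ 2)) (x * u) with h | h
  · have h1 : 0 ≤ 10 * x * (x * u - (1 - u ^ 2)) ^ 2 := by positivity
    have h2 : 0 ≤ u * (2 + u ^ 2) := by positivity
    have h3 := mul_le_mul_of_nonneg_right h h2
    have h4 : 0 ≤ (1 - u ^ 2) ^ 2 * u := by positivity
    nlinarith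
  · have h1 : (7 / 15 * (1 - u ^ 2)) ^ 2 ≤ (x * u - (1 - u ^ 2)) ^ 2 := by
      rw [← neg_sq (x * u - (1 - u ^ 2))]
      gcongr
      linarith
    have h2 : 10 * (1 / 2) * (7 / 15 * (1 - u ^ 2)) ^ 2 ≤
        10 * x * (x * u - (1 - u ^ 2)) ^ 2 := by gcongr
    have h3 : 5 * (1 / 2) * u ^ 2 * (2 + u ^ 2) ≤ 5 * x * u ^ 2 * (2 + u ^ 2) := by gcongr
    have h4 : 0 ≤ 49 / 45 * (1 - u ^ 2) ^ 2 + 5 * u ^ 2 + 5 / 2 * u ^ 4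
      - 4 * u * (1 - u ^ 4) := by
      have h5 : 0 ≤ u * (u ^ 2 - 1 / 5) ^ 2 := by positivity
      nlinarith [sq_nonneg (u ^ 2 - 1 / 5), sq_nonneg (u - 2 / 5),
        mul_nonneg hu0 (sq_nonneg (u - 2 / 5)), sq_nonneg (u * (u - 2 / 5)),
        mul_nonneg hu0 (sq_nonneg (u * (u - 2 / 5)))]
    nlinarith

lemma two_point_le_of_bounds (H : ℝ → ℝ) (H0 : ∀ x, 0 ≤ H x)
    (H1 : ∀ x, 8 / √(2 * π) * exp (15 / 16 * √(2 * π) * x - x ^ 2 / 2) ≤ H x)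
    (H2 : ∀ x, H x = x ^ 5 + 10 * x ^ 3 + 15 * x + H (-x))
    (p x : ℝ) (hp0 : 0 ≤ p) (hp1 : p ≤ 1) :
    (1 - p) * max 0 (x - 2 * p) ^ 5 + p * max 0 (x + 2 - 2 * p) ^ 5 ≤ H x := by
  rcases le_total (x + 2 - 2 * p) 0 with h | h
  · rw [max_eq_left h, max_eq_left (by linarith)]
    simpa using H0 x
  rw [max_eq_right h]
  rcases le_total (x - 2 * p) 0 with h' | h'
  · rw [max_eq_left h']
    rcases le_total x (2 / 5) with hx | hx
    · have e1 := mul_pow_five_le (2 + x) p (by linarith) (by linarith)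
      have e2 := pow_six_le_gaussian_bound x (by linarith) hx
      have e3 : 2 + x - 2 * p = x + 2 - 2 * p := by ring
      rw [e3] at e1
      linarith [H1 x]
    · have e1 := add_mul_two_sub_pow_five_le x (2 * p - x) hx (by linarith) (by linarith)
      have e3 : 2 - (2 * p - x) = x + 2 - 2 * p := by ring
      rw [e3] at e1
      have e4 : 0 ≤ x ^ 5 := by positivity
      have e5 : x ≤ 10 * x ^ 3 := by
        have : 0 ≤ x * (10 * x ^ 2 - 1) := mul_nonneg (by linarith) (by nlinarith)
        nlinarith
      have := H2 x
      have := H0 (-x)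
      linarith
  · rw [max_eq_right h']
    obtain ⟨u, rfl⟩ : ∃ u, p = (1 - u) / 2 := ⟨1 - 2 * p, by ring⟩
    have hx0 : 0 ≤ x := by linarith
    rw [H2 x]
    have hid : x ^ 5 + 10 * x ^ 3 + 15 * x - ((1 - (1 - u) / 2) * (x - 2 * ((1 - u) / 2)) ^ 5 +
        (1 - u) / 2 * (x + 2 - 2 * ((1 - u) / 2)) ^ 5) =
        10 * x * (x * u - (1 - u ^ 2)) ^ 2 + 5 * x * u ^ 2 * (2 + u ^ 2)
      - 4 * u * (1 - u ^ 4) := by ring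
    have hsq : 0 ≤ 10 * x * (x * u - (1 - u ^ 2)) ^ 2 := by positivity
    suffices 0 ≤ 10 * x * (x * u - (1 - u ^ 2)) ^ 2 + 5 * x * u ^ 2 * (2 + u ^ 2)
      - 4 * u * (1 - u ^ 4) + H (-x) by linarith
    rcases le_total u 0 with hu | hu
    · have e1 : 0 ≤ 5 * x * u ^ 2 * (2 + u ^ 2) := by positivity
      have e2 : u ^ 2 ≤ 1 := by nlinarith
      have e3 : 0 ≤ 1 - u ^ 4 := by nlinarith
      nlinarith [H0 (-x)]
    · rcases le_total x (1 / 2) with hx | hx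
      · have e1 := (le_gaussian_tail_bound x hx0 hx).trans (H1 (-x))
        have e2 : (1 - u) * (5 * u ^ 2 * (2 + u ^ 2) + 1) ≤ x * (5 * u ^ 2 * (2 + u ^ 2) + 1) := by
          gcongr
          linarith
        have e3 : 0 ≤ (1 - u) * (1 - u) ^ 4 := by
          have : 0 ≤ 1 - u := by linarith
          positivity
        nlinarith
      · have := quintic_defect_nonneg x u hx hu (by linarith)
        linarith [H0 (-x)]

lemma integrable_abs_pow_gaussian (k : ℕ) :
    Integrable (fun z : ℝ => |z| ^ k) (gaussianReal 0 1) := by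
  have h : MemLp id (k : ENNReal) (gaussianReal 0 1) :=
    memLp_id_gaussianReal' _ (by simp)
  simpa using h.integrable_norm_pow'

lemma integrable_pow_gaussian (k : ℕ) :
    Integrable (fun z : ℝ => z ^ k) (gaussianReal 0 1) := by
  refine (integrable_abs_pow_gaussian k).mono (by fun_prop) (ae_of_all _ fun z => ?_)
  simp

lemma integrable_posPart_pow_gaussian (x : ℝ) (k : ℕ) :
    Integrable (fun z : ℝ => max 0 (x + z) ^ k) (gaussianReal 0 1) := by
  have h : Integrable (fun z : ℝ => 2 ^ k * (|x| ^ k + |z| ^ k)) (gaussianReal 0 1) :=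
    ((integrable_const _).add (integrable_abs_pow_gaussian k)).const_mul _
  refine h.mono (by fun_prop) (ae_of_all _ fun z => ?_)
  rw [Real.norm_of_nonneg (by positivity), Real.norm_of_nonneg (by positivity)]
  have h1 : max 0 (x + z) ≤ 2 * max |x| |z| := by
    apply max_le (by positivity)
    linarith [le_abs_self x, le_abs_self z, le_max_left |x| |z|, le_max_right |x| |z|]
  calc max 0 (x + z) ^ k ≤ (2 * max |x| |z|) ^ k := by gcongr
    _ = 2 ^ k * max |x| |z| ^ k := mul_pow _ _ _
    _ ≤ _ := by
      gcongr
      rcases le_total |x| |z| with h | h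
      · rw [max_eq_right h]; linarith [show 0 ≤ |x| ^ k by positivity]
      · rw [max_eq_left h]; linarith [show 0 ≤ |z| ^ k by positivity]

lemma integral_posPart_pow_gaussian (k : ℕ) (hk : k ≠ 0) :
    ∫ z, max 0 z ^ k ∂(gaussianReal 0 1) =
      (√(2 * π))⁻¹ * ((1 / 2) ^ (-(k + 1 : ℝ) / 2) * (1 / 2) * Real.Gamma ((k + 1) / 2)) := by
  rw [integral_gaussianReal_eq_integral_smul one_ne_zero,
    ← integral_rpow_mul_exp_neg_mul_rpow (p := 2) (q := k) (b := 1 / 2) (by norm_num)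
      (by have : (0 : ℝ) ≤ k := by positivity
          linarith) (by norm_num),
    ← integral_const_mul, ← integral_indicator measurableSet_Ioi]
  congr 1
  ext z
  simp only [gaussianPDFReal_def, smul_eq_mul, Set.indicator, Set.mem_Ioi]
  split_ifs with h
  · rw [max_eq_right h.le]
    simp only [NNReal.coe_one, mul_one, sub_zero, Real.rpow_natCast, Real.rpow_ofNat]
    ring_nf
  · rw [max_eq_left (not_lt.mp h)]
    simp [hk]

lemma gamma_half_values : Real.Gamma (5 / 2) = 3 / 4 * √π ∧ Real.Gamma (7 / 2) = 15 / 8 * √π := by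
  have h3 : Real.Gamma (3 / 2) = 1 / 2 * √π := by
    rw [show (3 / 2 : ℝ) = 1 / 2 + 1 by norm_num, Real.Gamma_add_one (by norm_num),
      Real.Gamma_one_half_eq]
  have h5 : Real.Gamma (5 / 2) = 3 / 4 * √π := by
    rw [show (5 / 2 : ℝ) = 3 / 2 + 1 by norm_num, Real.Gamma_add_one (by norm_num), h3]
    ring
  refine ⟨h5, ?_⟩
  rw [show (7 / 2 : ℝ) = 5 / 2 + 1 by norm_num, Real.Gamma_add_one (by norm_num), h5]
  ring

lemma half_rpow_neg_half (k : ℕ) : (1 / 2 : ℝ) ^ (-((2 * k : ℝ) + 1) / 2) = 2 ^ k * √2 := by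
  rw [one_div, Real.inv_rpow (by norm_num), ← Real.rpow_neg (by norm_num),
    show -(-((2 * k : ℝ) + 1) / 2) = k + 1 / 2 by ring, Real.rpow_add (by norm_num),
    Real.rpow_natCast, Real.sqrt_eq_rpow]

lemma integral_posPart_pow_four_gaussian :
    ∫ z, max 0 z ^ 4 ∂(gaussianReal 0 1) = 3 / 2 := by
  rw [integral_posPart_pow_gaussian 4 (by norm_num)]
  have := half_rpow_neg_half 2
  norm_num at this ⊢
  rw [this, gamma_half_values.1]
  have h2 : √2 ≠ 0 := by positivity
  have hp : √π ≠ 0 := by positivity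
  field_simp

lemma integral_posPart_pow_six_gaussian :
    ∫ z, max 0 z ^ 6 ∂(gaussianReal 0 1) = 15 / 2 := by
  rw [integral_posPart_pow_gaussian 6 (by norm_num)]
  have := half_rpow_neg_half 3
  norm_num at this ⊢
  rw [this, gamma_half_values.2]
  have h2 : √2 ≠ 0 := by positivity
  have hp : √π ≠ 0 := by positivity
  field_simp

lemma integral_posPart_pow_five_gaussian :
    ∫ z, max 0 z ^ 5 ∂(gaussianReal 0 1) = 8 / √(2 * π) := by
  rw [integral_posPart_pow_gaussian 5 (by norm_num)]
  norm_num
  ring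

lemma integral_comp_neg_gaussian (f : ℝ → ℝ) :
    ∫ z, f (-z) ∂(gaussianReal 0 1) = ∫ z, f z ∂(gaussianReal 0 1) := by
  have h := gaussianReal_map_neg (μ := 0) (v := 1)
  rw [neg_zero] at h
  conv_rhs => rw [← h]
  exact ((MeasurableEquiv.neg ℝ).measurableEmbedding.integral_map f).symm

lemma integral_odd_pow_gaussian (k : ℕ) (hk : Odd k) :
    ∫ z, z ^ k ∂(gaussianReal 0 1) = 0 := by
  have h := integral_comp_neg_gaussian (fun z => z ^ k)
  simp only [hk.neg_pow, integral_neg] at h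
  linarith

lemma integral_sq_gaussian : ∫ z, z ^ 2 ∂(gaussianReal 0 1) = 1 := by
  have h := variance_fun_id_gaussianReal (μ := 0) (v := 1)
  rw [variance_eq_integral (by fun_prop)] at h
  simpa using h

lemma integral_pow_four_gaussian : ∫ z, z ^ 4 ∂(gaussianReal 0 1) = 3 := by
  have h : ∀ z : ℝ, z ^ 4 = max 0 z ^ 4 + max 0 (-z) ^ 4 := by
    intro z
    rcases le_total 0 z with h | h
    · rw [max_eq_right h, max_eq_left (by linarith)]; ring
    · rw [max_eq_left h, max_eq_right (by linarith)]; ring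
  have hi : Integrable (fun z : ℝ => max 0 z ^ 4) (gaussianReal 0 1) := by
    simpa using integrable_posPart_pow_gaussian 0 4
  have hi' : Integrable (fun z : ℝ => max 0 (-z) ^ 4) (gaussianReal 0 1) := by
    refine (integrable_pow_gaussian 4).mono (by fun_prop) (ae_of_all _ fun z => ?_)
    rw [Real.norm_of_nonneg (by positivity), Real.norm_of_nonneg (by positivity), h z]
    linarith [show 0 ≤ max 0 z ^ 4 by positivity]
  rw [integral_congr_ae (ae_of_all _ h), integral_add hi hi', integral_comp_neg_gaussian (fun z => max 0 z ^ 4),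
    integral_posPart_pow_four_gaussian]
  norm_num

lemma integral_add_pow_five_gaussian (x : ℝ) :
    ∫ z, (x + z) ^ 5 ∂(gaussianReal 0 1) = x ^ 5 + 10 * x ^ 3 + 15 * x := by
  have h : ∀ z : ℝ, (x + z) ^ 5 = x ^ 5 + 5 * x ^ 4 * z ^ 1 + 10 * x ^ 3 * z ^ 2
      + 10 * x ^ 2 * z ^ 3 + 5 * x * z ^ 4 + z ^ 5 := fun z => by ring
  have hi : ∀ (c : ℝ) (k : ℕ), Integrable (fun z : ℝ => c * z ^ k) (gaussianReal 0 1) :=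
    fun c k => (integrable_pow_gaussian k).const_mul c
  have h0 : Integrable (fun _ : ℝ => x ^ 5) (gaussianReal 0 1) := integrable_const _
  simp_rw [h]
  have h1 := h0.fun_add (hi (5 * x ^ 4) 1)
  have h2 := h1.fun_add (hi (10 * x ^ 3) 2)
  have h3 := h2.fun_add (hi (10 * x ^ 2) 3)
  have h4 := h3.fun_add (hi (5 * x) 4)
  rw [integral_add h4 (integrable_pow_gaussian 5), integral_add h3 (hi _ _),
    integral_add h2 (hi _ _), integral_add h1 (hi _ _), integral_add h0 (hi _ _)]
  simp only [integral_const_mul, integral_sq_gaussian, integral_pow_four_gaussian,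
    integral_odd_pow_gaussian 1 (by decide), integral_odd_pow_gaussian 3 (by decide),
    integral_odd_pow_gaussian 5 (by decide)]
  simp
  ring

lemma integral_posPart_add_pow_five_reflection (x : ℝ) :
    ∫ z, max 0 (x + z) ^ 5 ∂(gaussianReal 0 1) =
      x ^ 5 + 10 * x ^ 3 + 15 * x + ∫ z, max 0 (-x + z) ^ 5 ∂(gaussianReal 0 1) := by
  have hneg : Integrable (fun z : ℝ => max 0 (-x + -z) ^ 5) (gaussianReal 0 1) := by
    have h := integrable_posPart_pow_gaussian (-x) 5
    have h2 := gaussianReal_map_neg (μ := 0) (v := 1)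
    rw [neg_zero] at h2
    rw [← h2] at h
    exact h.comp_measurable measurable_neg
  rw [← integral_add_pow_five_gaussian, ← integral_comp_neg_gaussian (fun z => max 0 (-x + z) ^ 5),
    ← sub_eq_iff_eq_add, ← integral_sub (integrable_posPart_pow_gaussian x 5) hneg]
  congr 1
  ext z
  rcases le_total 0 (x + z) with h | h
  · rw [max_eq_right h, max_eq_left (by linarith)]; ring
  · rw [max_eq_left h, max_eq_right (by linarith)]; ring

lemma exp_tilt_le_integral_posPart_pow_five (x : ℝ) :
    8 / √(2 * π) * exp (15 / 16 * √(2 * π) * x - x ^ 2 / 2) ≤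
      ∫ z, max 0 (x + z) ^ 5 ∂(gaussianReal 0 1) := by
  set m := 15 / 16 * √(2 * π) with hm
  have hi : ∀ k : ℕ, Integrable (fun z : ℝ => max 0 z ^ k) (gaussianReal 0 1) := fun k => by
    simpa using integrable_posPart_pow_gaussian 0 k
  have hdens : ∀ {f : ℝ → ℝ}, Integrable f (gaussianReal 0 1) →
      Integrable (fun z => gaussianPDFReal 0 1 z * f z) := by
    intro f hf
    rw [gaussianReal_of_var_ne_zero _ one_ne_zero,
      integrable_withDensity_iff_integrable_smul' (measurable_gaussianPDF _ _)
        (ae_of_all _ fun _ => gaussianPDF_lt_top)] at hf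
    simpa using hf
  have hlin : Integrable (fun z : ℝ => exp (m * x - x ^ 2 / 2) *
      ((1 - x * m) * max 0 z ^ 5 + x * max 0 z ^ 6)) (gaussianReal 0 1) :=
    (((hi 5).const_mul _).add ((hi 6).const_mul _)).const_mul _
  have hL : ∫ z, exp (m * x - x ^ 2 / 2) *
      ((1 - x * m) * max 0 z ^ 5 + x * max 0 z ^ 6) ∂(gaussianReal 0 1) =
      8 / √(2 * π) * exp (m * x - x ^ 2 / 2) := by
    rw [integral_const_mul, integral_add ((hi 5).const_mul _) ((hi 6).const_mul _),
      integral_const_mul, integral_const_mul, integral_posPart_pow_five_gaussian,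
      integral_posPart_pow_six_gaussian, hm]
    have : √(2 * π) ≠ 0 := by positivity
    field_simp
    ring
  rw [← hL, integral_gaussianReal_eq_integral_smul one_ne_zero,
    integral_gaussianReal_eq_integral_smul one_ne_zero]
  rw [← integral_sub_right_eq_self (fun z => gaussianPDFReal 0 1 z • max 0 (x + z) ^ 5) x]
  simp only [smul_eq_mul]
  refine integral_mono (hdens hlin)
    ((hdens (integrable_posPart_pow_gaussian x 5)).comp_sub_right x) fun z => ?_
  rcases le_total z 0 with hz | hz
  · simp [hz]
  · have e1 : gaussianPDFReal 0 1 (z - x) =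
        gaussianPDFReal 0 1 z * exp (m * x - x ^ 2 / 2) * exp (x * (z - m)) := by
      simp only [gaussianPDFReal_def]
      rw [mul_assoc _ _ (rexp (x * (z - m))), ← Real.exp_add, mul_assoc _ _ (rexp (_ + _)),
        ← Real.exp_add]
      congr 2
      simp
      ring
    have e2 := Real.add_one_le_exp (x * (z - m))
    have e3 := gaussianPDFReal_nonneg 0 1 z
    simp only [e1, max_eq_right hz, add_sub_cancel]
    calc _ = gaussianPDFReal 0 1 z * exp (m * x - x ^ 2 / 2) * (x * (z - m) + 1) * z ^ 5 := by ring
      _ ≤ _ := by gcongr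

lemma two_point_le_integral_gaussian (p x : ℝ) (hp0 : 0 ≤ p) (hp1 : p ≤ 1) :
    (1 - p) * max 0 (x - 2 * p) ^ 5 + p * max 0 (x + 2 - 2 * p) ^ 5 ≤
      ∫ z, max 0 (x + z) ^ 5 ∂(gaussianReal 0 1) :=
  two_point_le_of_bounds (fun x => ∫ z, max 0 (x + z) ^ 5 ∂(gaussianReal 0 1))
    (fun _ => integral_nonneg fun _ => by positivity)
    exp_tilt_le_integral_posPart_pow_five integral_posPart_add_pow_five_reflection p x hp0 hp1

lemma posPart_smul_pow (s x y : ℝ) (hs : 0 < s) (k : ℕ) (h : x = s * y) :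
    max 0 x ^ k = s ^ k * max 0 y ^ k := by
  rw [h, ← mul_pow, mul_max_of_nonneg _ _ hs.le, mul_zero]

lemma integrable_posPart_scaled_gaussian (x s : ℝ) (hs : 0 < s) :
    Integrable (fun z : ℝ => max 0 (x + s * z) ^ 5) (gaussianReal 0 1) := by
  have h : ∀ z, max 0 (x + s * z) ^ 5 = s ^ 5 * max 0 (x / s + z) ^ 5 := fun z =>
    posPart_smul_pow s _ _ hs 5 (by field_simp)
  simp_rw [h]
  exact (integrable_posPart_pow_gaussian _ _).const_mul _

lemma scaled_two_point_le_integral_gaussian (s c x : ℝ) (hs : 0 < s) (hc0 : c ≤ 0)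
    (hc : -(2 * s) ≤ c) :
    max 0 (x + c) ^ 5 - c * ((max 0 (x + c + 2 * s) ^ 5 - max 0 (x + c) ^ 5) / (2 * s)) ≤
      ∫ z, max 0 (x + s * z) ^ 5 ∂(gaussianReal 0 1) := by
  have h : ∀ z, max 0 (x + s * z) ^ 5 = s ^ 5 * max 0 (x / s + z) ^ 5 := fun z =>
    posPart_smul_pow s _ _ hs 5 (by field_simp)
  have key := two_point_le_integral_gaussian (-c / (2 * s)) (x / s)
    (div_nonneg (by linarith) (by linarith)) (by rw [div_le_one (by linarith)]; linarith)
  simp_rw [h]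
  rw [integral_const_mul,
    posPart_smul_pow s (x + c) (x / s - 2 * (-c / (2 * s))) hs 5 (by field_simp; ring),
    posPart_smul_pow s (x + c + 2 * s) (x / s + 2 - 2 * (-c / (2 * s))) hs 5
      (by field_simp; ring)]
  refine le_trans (le_of_eq ?_) (mul_le_mul_of_nonneg_left key (by positivity : 0 ≤ s ^ 5))
  field_simp
  ring

lemma posPart_pow_le_integral_gaussian (s x : ℝ) (hs : 0 < s) :
    max 0 x ^ 5 ≤ ∫ z, max 0 (x + s * z) ^ 5 ∂(gaussianReal 0 1) := by
  simpa using scaled_two_point_le_integral_gaussian s 0 x hs le_rfl (by linarith)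

lemma convexOn_posPart_pow (k : ℕ) : ConvexOn ℝ Set.univ (fun x : ℝ => max 0 x ^ k) :=
  ((convexOn_const 0 convex_univ).sup (convexOn_id convex_univ)).pow
    (fun _ _ => le_max_left _ _) k

lemma posPart_pow_le_chord (s c x y : ℝ) (hs : 0 < s) (h1 : c ≤ y) (h2 : y ≤ c + 2 * s) :
    max 0 (x + y) ^ 5 ≤ max 0 (x + c) ^ 5 +
      (y - c) * ((max 0 (x + c + 2 * s) ^ 5 - max 0 (x + c) ^ 5) / (2 * s)) := by
  have hconv := (convexOn_posPart_pow 5).2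
  have h := hconv (Set.mem_univ (x + c)) (Set.mem_univ (x + c + 2 * s))
    (a := 1 - (y - c) / (2 * s)) (b := (y - c) / (2 * s))
    (by rw [sub_nonneg, div_le_one (by linarith)]; linarith)
    (div_nonneg (by linarith) (by linarith)) (by ring)
  simp only [smul_eq_mul] at h
  have e : (1 - (y - c) / (2 * s)) * (x + c) + (y - c) / (2 * s) * (x + c + 2 * s) = x + y := by
    field_simp; ring
  rw [e] at h
  refine h.trans (le_of_eq ?_)
  ring

/-- Slope of the chord of `x ↦ max 0 x ^ 5` over `[x + c, x + c + 2 * s]`, set to zero when that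
interval lies to the left of `x`. -/
noncomputable def chordSlope (s c x : ℝ) : ℝ :=
  if -(2 * s) ≤ c then (max 0 (x + c + 2 * s) ^ 5 - max 0 (x + c) ^ 5) / (2 * s) else 0

lemma chordSlope_nonneg (s c x : ℝ) (hs : 0 < s) : 0 ≤ chordSlope s c x := by
  unfold chordSlope
  split_ifs
  · apply div_nonneg _ (by linarith)
    rw [sub_nonneg]
    exact pow_le_pow_left₀ (le_max_left _ _) (max_le_max le_rfl (by linarith)) 5
  · exact le_rfl

lemma chordSlope_le (s c x M : ℝ) (hs : 0 < s) (hc : c ≤ 0) (hx : x ≤ M) :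
    chordSlope s c x ≤ max 0 (M + 2 * s) ^ 5 / (2 * s) := by
  unfold chordSlope
  split_ifs
  · gcongr
    have h1 : 0 ≤ max 0 (x + c) ^ 5 := by positivity
    have h2 : max 0 (x + c + 2 * s) ^ 5 ≤ max 0 (M + 2 * s) ^ 5 := by
      gcongr
      linarith
    linarith
  · positivity

lemma measurable_chordSlope (s : ℝ) : Measurable (fun q : ℝ × ℝ => chordSlope s q.1 q.2) := by
  unfold chordSlope
  refine Measurable.ite (measurableSet_le measurable_const measurable_fst) ?_ measurable_const
  fun_prop

lemma posPart_pow_le_integral_add_chordSlope (s c x y : ℝ) (hs : 0 < s) (hc : c ≤ 0)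
    (h1 : c ≤ y) (h2 : y ≤ c + 2 * s) :
    max 0 (x + y) ^ 5 ≤
      (∫ z, max 0 (x + s * z) ^ 5 ∂(gaussianReal 0 1)) + chordSlope s c x * y := by
  unfold chordSlope
  split_ifs with h
  · linarith [posPart_pow_le_chord s c x y hs h1 h2,
      scaled_two_point_le_integral_gaussian s c x hs hc h]
  · rw [zero_mul, add_zero]
    refine le_trans ?_ (posPart_pow_le_integral_gaussian s x hs)
    gcongr
    linarith

section

variable {Ω : Type*} {m m0 : MeasurableSpace Ω} {μ : Measure Ω} [IsProbabilityMeasure μ]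

lemma integrable_prod_posPart_pow {Y : Ω → ℝ} (hY : AEStronglyMeasurable Y μ) (M s : ℝ)
    (hs : 0 < s) (hM : ∀ᵐ ω ∂μ, Y ω ≤ M) :
    Integrable (fun q : Ω × ℝ => max 0 (Y q.1 + s * q.2) ^ 5) (μ.prod (gaussianReal 0 1)) := by
  have h : Integrable (fun q : Ω × ℝ => max 0 (M + s * q.2) ^ 5) (μ.prod (gaussianReal 0 1)) :=
    (integrable_posPart_scaled_gaussian M s hs).comp_snd μ
  have hY' : AEMeasurable (fun q : Ω × ℝ => Y q.1) (μ.prod (gaussianReal 0 1)) :=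
    hY.comp_fst.aemeasurable
  refine h.mono ((aemeasurable_const.sup (hY'.add
    (measurable_snd.aemeasurable.const_mul s))).pow_const 5).aestronglyMeasurable ?_
  have hM' : ∀ᵐ q ∂(μ.prod (gaussianReal 0 1)), Y q.1 ≤ M :=
    Measure.quasiMeasurePreserving_fst.ae hM
  filter_upwards [hM'] with q hq
  rw [Real.norm_of_nonneg (by positivity), Real.norm_of_nonneg (by positivity)]
  gcongr

lemma integral_mul_nonpos_of_condExp_nonpos (hm : m ≤ m0) {k X : Ω → ℝ}
    (hk : StronglyMeasurable[m] k) (hX : Integrable X μ) (c : ℝ)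
    (hk0 : ∀ ω, 0 ≤ k ω) (hkc : ∀ᵐ ω ∂μ, k ω ≤ c) (hcond : μ[X|m] ≤ᵐ[μ] 0) :
    Integrable (fun ω => k ω * X ω) μ ∧ ∫ ω, k ω * X ω ∂μ ≤ 0 := by
  have hb : ∀ᵐ ω ∂μ, ‖k ω‖ ≤ c := by
    filter_upwards [hkc] with ω h
    rwa [Real.norm_of_nonneg (hk0 ω)]
  refine ⟨hX.bdd_mul (hk.mono hm).aestronglyMeasurable hb, ?_⟩
  have h := condExp_stronglyMeasurable_mul_of_bound hm hk hX c hb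
  change ∫ ω, (k * X) ω ∂μ ≤ 0
  rw [← integral_condExp hm, integral_congr_ae h]
  apply integral_nonpos_of_ae
  filter_upwards [hcond] with ω hω
  exact mul_nonpos_of_nonneg_of_nonpos (hk0 ω) hω

lemma integral_posPart_pow_add_le (hm : m ≤ m0) {Y X C : Ω → ℝ} (s M : ℝ) (hs : 0 < s)
    (hY : StronglyMeasurable[m] Y) (hC : StronglyMeasurable[m] C) (hX : Integrable X μ)
    (hM : ∀ᵐ ω ∂μ, Y ω ≤ M) (hC0 : ∀ᵐ ω ∂μ, C ω ≤ 0)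
    (hCX : ∀ᵐ ω ∂μ, C ω ≤ X ω ∧ X ω ≤ C ω + 2 * s) (hcond : μ[X|m] ≤ᵐ[μ] 0) :
    ∫ ω, max 0 (Y ω + X ω) ^ 5 ∂μ ≤
      ∫ ω, ∫ z, max 0 (Y ω + s * z) ^ 5 ∂(gaussianReal 0 1) ∂μ := by
  have hk : StronglyMeasurable[m] (fun ω => chordSlope s (C ω) (Y ω)) :=
    ((measurable_chordSlope s).comp (hC.measurable.prodMk hY.measurable)).stronglyMeasurable
  obtain ⟨hi, hle⟩ := integral_mul_nonpos_of_condExp_nonpos hm hk hX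
    (max 0 (M + 2 * s) ^ 5 / (2 * s)) (fun ω => chordSlope_nonneg s _ _ hs)
    (by filter_upwards [hM, hC0] with ω h1 h2 using chordSlope_le s _ _ M hs h2 h1) hcond
  have hg := (integrable_prod_posPart_pow (hY.mono hm).aestronglyMeasurable M s hs
    hM).integral_prod_left
  calc ∫ ω, max 0 (Y ω + X ω) ^ 5 ∂μ
      ≤ ∫ ω, ((∫ z, max 0 (Y ω + s * z) ^ 5 ∂(gaussianReal 0 1)) +
          chordSlope s (C ω) (Y ω) * X ω) ∂μ := by
        apply integral_mono_of_nonneg (ae_of_all _ fun ω => by positivity) (hg.add hi)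
        filter_upwards [hC0, hCX] with ω h1 h2
        exact posPart_pow_le_integral_add_chordSlope s _ _ _ hs h1 h2.1 h2.2
    _ = _ := integral_add hg hi
    _ ≤ _ := by linarith

end

lemma map_prod_gaussian_add (a b : ℝ) :
    ((gaussianReal 0 1).prod (gaussianReal 0 1)).map (fun q : ℝ × ℝ => a * q.1 + b * q.2) =
      (gaussianReal 0 1).map (fun z => √(a ^ 2 + b ^ 2) * z) := by
  have h1 : ∀ c : ℝ, ((gaussianReal 0 1).prod (gaussianReal 0 1)).map (fun q : ℝ × ℝ => c * q.1) =
      (gaussianReal 0 1).map (fun z => c * z) := by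
    intro c
    rw [← Function.comp_def (fun z => c * z) Prod.fst,
      ← Measure.map_map (by fun_prop) measurable_fst, Measure.map_fst_prod]
    simp
  have h2 : ∀ c : ℝ, ((gaussianReal 0 1).prod (gaussianReal 0 1)).map (fun q : ℝ × ℝ => c * q.2) =
      (gaussianReal 0 1).map (fun z => c * z) := by
    intro c
    rw [← Function.comp_def (fun z => c * z) Prod.snd,
      ← Measure.map_map (by fun_prop) measurable_snd, Measure.map_snd_prod]
    simp
  have hind : IndepFun (fun q : ℝ × ℝ => a * q.1) (fun q : ℝ × ℝ => b * q.2)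
      ((gaussianReal 0 1).prod (gaussianReal 0 1)) :=
    indepFun_prod (X := fun z => a * z) (Y := fun z => b * z) (by fun_prop) (by fun_prop)
  have h := gaussianReal_add_gaussianReal_of_indepFun hind
    ((h1 a).trans (gaussianReal_map_const_mul a)) ((h2 b).trans (gaussianReal_map_const_mul b))
  refine h.trans ?_
  rw [gaussianReal_map_const_mul]
  congr 1
  · simp
  · ext
    simp [Real.sq_sqrt (by positivity : 0 ≤ a ^ 2 + b ^ 2)]

lemma integrable_prod_gaussian_posPart_pow (a b t : ℝ) (hb : 0 < b) :
    Integrable (fun q : ℝ × ℝ => max 0 (a * q.1 + b * q.2 - t) ^ 5)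
      ((gaussianReal 0 1).prod (gaussianReal 0 1)) := by
  have hpos : 0 < √(a ^ 2 + b ^ 2) := by positivity
  have h := integrable_posPart_scaled_gaussian (-t) _ hpos
  have h1 : Integrable (fun w : ℝ => max 0 (w - t) ^ 5)
      ((gaussianReal 0 1).map (fun z => √(a ^ 2 + b ^ 2) * z)) := by
    rw [integrable_map_measure (by fun_prop) (by fun_prop)]
    refine h.congr (ae_of_all _ fun z => ?_)
    simp only [Function.comp]
    ring_nf
  rw [← map_prod_gaussian_add] at h1
  exact h1.comp_measurable (by fun_prop)

lemma integral_integral_gaussian_posPart_pow (a b t : ℝ) (hb : 0 < b) :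
    ∫ w, ∫ z, max 0 (a * z + b * w - t) ^ 5 ∂(gaussianReal 0 1) ∂(gaussianReal 0 1) =
      ∫ z, max 0 (√(a ^ 2 + b ^ 2) * z - t) ^ 5 ∂(gaussianReal 0 1) := by
  have h := integrable_prod_gaussian_posPart_pow a b t hb
  rw [← integral_prod_symm _ h,
    ← integral_map (φ := fun z => √(a ^ 2 + b ^ 2) * z)
      (f := fun w => max 0 (w - t) ^ 5) (by fun_prop) (by fun_prop),
    ← map_prod_gaussian_add, integral_map (by fun_prop) (by fun_prop)]

/-- moment comparison for bounded-difference supermartingales. -/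
theorem supermartingale_moment_comparison
    {Ω : Type*} {m0 : MeasurableSpace Ω} {μ : Measure Ω} [IsProbabilityMeasure μ]
    (ℱ : Filtration ℕ m0) (S : ℕ → Ω → ℝ) (hS : Supermartingale S ℱ μ)
    (hS0 : ∀ᵐ ω ∂μ, S 0 ω ≤ 0)
    (n : ℕ) (C D : ℕ → Ω → ℝ) (s : ℕ → ℝ)
    (hs : ∀ i ∈ Finset.Icc 1 n, 0 < s i)
    (hCmeas : ∀ i ∈ Finset.Icc 1 n, StronglyMeasurable[ℱ (i - 1)] (C (i - 1)))
    (hDmeas : ∀ i ∈ Finset.Icc 1 n, StronglyMeasurable[ℱ (i - 1)] (D (i - 1)))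
    (hCD : ∀ i ∈ Finset.Icc 1 n, ∀ᵐ ω ∂μ,
      C (i - 1) ω ≤ S i ω - S (i - 1) ω ∧ S i ω - S (i - 1) ω ≤ D (i - 1) ω ∧
        D (i - 1) ω - C (i - 1) ω ≤ 2 * s i)
    (t : ℝ) :
    ∫ ω, max 0 (S n ω - t) ^ 5 ∂μ ≤
      ∫ z, max 0 (Real.sqrt (∑ i ∈ Finset.Icc 1 n, s i ^ 2) * z - t) ^ 5
        ∂(gaussianReal 0 1) := by
  suffices h : (∃ M : ℝ, ∀ᵐ ω ∂μ, S n ω ≤ M) ∧ ∀ t : ℝ, ∫ ω, max 0 (S n ω - t) ^ 5 ∂μ ≤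
      ∫ z, max 0 (Real.sqrt (∑ i ∈ Finset.Icc 1 n, s i ^ 2) * z - t) ^ 5
        ∂(gaussianReal 0 1) from h.2 t
  clear t hDmeas
  induction n with
  | zero =>
    refine ⟨⟨0, hS0⟩, fun t => ?_⟩
    have h : ∫ ω, max 0 (S 0 ω - t) ^ 5 ∂μ ≤ ∫ _, max 0 (-t) ^ 5 ∂μ := by
      apply integral_mono_of_nonneg (ae_of_all _ fun ω => by positivity) (integrable_const _)
      filter_upwards [hS0] with ω h
      gcongr
      linarith
    simpa using h
  | succ n ih =>
    have hsub : ∀ i ∈ Finset.Icc 1 n, i ∈ Finset.Icc 1 (n + 1) := fun i hi => by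
      simp only [Finset.mem_Icc] at hi ⊢
      omega
    obtain ⟨⟨M, hM⟩, ih⟩ := ih (fun i hi => hs i (hsub i hi)) (fun i hi => hCmeas i (hsub i hi))
      (fun i hi => hCD i (hsub i hi))
    have hmem : n + 1 ∈ Finset.Icc 1 (n + 1) := by simp
    have hs' := hs _ hmem
    have hC := hCmeas _ hmem
    have hCX : ∀ᵐ ω ∂μ, C n ω ≤ S (n + 1) ω - S n ω ∧
        S (n + 1) ω - S n ω ≤ C n ω + 2 * s (n + 1) := by
      filter_upwards [hCD _ hmem] with ω h
      simp only [Nat.add_sub_cancel] at h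
      exact ⟨h.1, by linarith [h.2.1, h.2.2]⟩
    simp only [Nat.add_sub_cancel] at hC
    have hX : Integrable (S (n + 1) - S n) μ := (hS.integrable _).sub (hS.integrable _)
    have hcond : μ[S (n + 1) - S n|ℱ n] ≤ᵐ[μ] 0 := by
      have h1 := condExp_sub (hS.integrable (n + 1)) (hS.integrable n) (ℱ n)
      have h2 := hS.condExp_ae_le (Nat.le_succ n)
      rw [condExp_of_stronglyMeasurable (ℱ.le n) (hS.stronglyMeasurable n)
        (hS.integrable n)] at h1
      filter_upwards [h1, h2] with ω h1 h2
      rw [h1]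
      simpa using h2
    have hCint : Integrable (C n) μ := by
      have hb : Integrable (fun ω => |(S (n + 1) - S n) ω| + 2 * s (n + 1)) μ :=
        hX.abs.add (integrable_const _)
      refine hb.mono' (hC.mono (ℱ.le n)).aestronglyMeasurable ?_
      filter_upwards [hCX] with ω h
      rw [Real.norm_eq_abs, Pi.sub_apply, abs_le]
      constructor
      · linarith [neg_abs_le (S (n + 1) ω - S n ω)]
      · linarith [le_abs_self (S (n + 1) ω - S n ω)]
    have hC0 : ∀ᵐ ω ∂μ, C n ω ≤ 0 := by
      have h := condExp_mono (m := ℱ n) hCint hX (hCX.mono fun ω h => h.1)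
      rw [condExp_of_stronglyMeasurable (ℱ.le n) hC hCint] at h
      exact h.trans hcond
    refine ⟨⟨M + 2 * s (n + 1), ?_⟩, fun t => ?_⟩
    · filter_upwards [hM, hCX, hC0] with ω h1 h2 h3
      linarith [h2.2]
    have hYM : ∀ᵐ ω ∂μ, S n ω - t ≤ M - t := hM.mono fun ω h => by linarith
    have hYmeas : StronglyMeasurable[ℱ n] (fun ω => S n ω - t) :=
      (hS.stronglyMeasurable n).sub stronglyMeasurable_const
    have hstep := integral_posPart_pow_add_le (ℱ.le n) (s (n + 1)) (M - t) hs' hYmeas hC hX hYM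
      hC0 hCX hcond
    have hprod := integrable_prod_posPart_pow (hYmeas.mono (ℱ.le n)).aestronglyMeasurable
      (M - t) (s (n + 1)) hs' hYM
    rw [integral_integral_swap hprod] at hstep
    have hsum : ∑ i ∈ Finset.Icc 1 (n + 1), s i ^ 2 =
        √(∑ i ∈ Finset.Icc 1 n, s i ^ 2) ^ 2 + s (n + 1) ^ 2 := by
      rw [Real.sq_sqrt (Finset.sum_nonneg fun i _ => sq_nonneg _),
        Finset.sum_Icc_succ_top (by omega)]
    rw [hsum, ← integral_integral_gaussian_posPart_pow _ _ _ hs']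
    calc ∫ ω, max 0 (S (n + 1) ω - t) ^ 5 ∂μ
        = ∫ ω, max 0 (S n ω - t + (S (n + 1) - S n) ω) ^ 5 ∂μ := by
          congr 1; ext ω; simp only [Pi.sub_apply]; ring_nf
      _ ≤ _ := hstep
      _ ≤ _ := by
          refine integral_mono hprod.integral_prod_right
            (integrable_prod_gaussian_posPart_pow _ _ t hs').integral_prod_right fun w => ?_
          have h := ih (t - s (n + 1) * w)
          refine le_of_eq_of_le ?_ (h.trans_eq ?_) <;> (congr 1; ext; ring_nf)
end

section
/- Let $X$ be a real-valued random variable and let $c < 0 < d$ be real constants. If $\mathsf{E} X = 0$ and $\P(c \le X \le d) = 1$, then $\mathsf{Var}\, X \le |c|\, d$. -/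
open MeasureTheory

/-- a mean-zero random variable taking values in `[c, d]` with `c < 0 < d`
has variance at most `|c| * d`. -/
theorem variance_le_of_mean_zero_of_mem_Icc
    {Ω : Type*} {m0 : MeasurableSpace Ω} {μ : Measure Ω} [IsProbabilityMeasure μ]
    (X : Ω → ℝ) (hInt : Integrable X μ) (c d : ℝ) (hc : c < 0) (hd : 0 < d)
    (hEX : ∫ ω, X ω ∂μ = 0) (hb : ∀ᵐ ω ∂μ, c ≤ X ω ∧ X ω ≤ d) :
    (∫ ω, X ω ^ 2 ∂μ) - (∫ ω, X ω ∂μ) ^ 2 ≤ |c| * d := by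
  have h := ProbabilityTheory.variance_le_sub_mul_sub hb hInt.aemeasurable
  rw [ProbabilityTheory.variance_of_integral_eq_zero hInt.aemeasurable hEX, hEX] at h
  rw [hEX, abs_of_neg hc]
  linarith
end

section
/- Let $\alpha > 1$ and $0 < \beta < \alpha$ be real numbers. Then $k_{1;\alpha,\beta} \le \dfrac{\Gamma(1+\beta)\,\Gamma(\alpha-\beta)}{\Gamma(\alpha)}$, where $k_{1;\alpha,\beta} := \sup_{\sigma > 0}\, \sigma^{-\beta(\alpha-1)} \big( \int_0^\sigma \beta s^{\beta-1}(1+s)^{-1}\, ds \big)^{\alpha}$ and $\Gamma$ is the Euler gamma function. -/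
open MeasureTheory Real

lemma integrableOn_rpow_mul_one_sub_rpow {u v : ℝ} (hu : 0 < u) (hv : 0 < v) :
    IntegrableOn (fun x : ℝ => x ^ (u - 1) * (1 - x) ^ (v - 1)) (Set.Ioo 0 1) := by
  have h := Complex.betaIntegral_convergent (u := u) (v := v) (by simpa) (by simpa)
  rw [intervalIntegrable_iff_integrableOn_Ioo_of_le zero_le_one] at h
  refine IntegrableOn.congr_fun (Integrable.re h) (fun x hx => ?_) measurableSet_Ioo
  have hx' : 0 ≤ 1 - x := by linarith [hx.2]
  rw [← Complex.ofReal_re (x ^ (u - 1) * (1 - x) ^ (v - 1)), Complex.ofReal_mul,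
    Complex.ofReal_cpow hx.1.le, Complex.ofReal_cpow hx']
  simp

lemma integral_rpow_mul_one_sub_rpow {u v : ℝ} (hu : 0 < u) (hv : 0 < v) :
    ∫ x in Set.Ioo (0 : ℝ) 1, x ^ (u - 1) * (1 - x) ^ (v - 1) = ProbabilityTheory.beta u v := by
  have key : ((∫ x in Set.Ioo (0 : ℝ) 1, x ^ (u - 1) * (1 - x) ^ (v - 1) : ℝ) : ℂ) =
      Complex.betaIntegral u v := by
    rw [Complex.betaIntegral, intervalIntegral.integral_of_le zero_le_one,
      integral_Ioc_eq_integral_Ioo, ← integral_complex_ofReal]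
    refine setIntegral_congr_fun measurableSet_Ioo fun x hx => ?_
    have hx' : 0 ≤ 1 - x := by linarith [hx.2]
    simp [Complex.ofReal_cpow hx.1.le, Complex.ofReal_cpow hx']
  rw [ProbabilityTheory.beta_eq_betaIntegralReal u v hu hv, ← key, Complex.ofReal_re]

lemma image_div_one_add_Ioi :
    (fun s : ℝ => s / (1 + s)) '' Set.Ioi 0 = Set.Ioo 0 1 := by
  ext x
  constructor
  · rintro ⟨s, hs : 0 < s, rfl⟩
    exact ⟨by positivity, (div_lt_one (by positivity)).2 (by linarith)⟩
  · rintro ⟨h0, h1⟩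
    have h : 0 < 1 - x := by linarith
    refine ⟨x / (1 - x), div_pos h0 h, ?_⟩
    field_simp
    ring

lemma injOn_div_one_add_Ioi : Set.InjOn (fun s : ℝ => s / (1 + s)) (Set.Ioi 0) := by
  intro a (ha : 0 < a) b (hb : 0 < b) h
  have ha' : 1 + a ≠ 0 := by positivity
  have hb' : 1 + b ≠ 0 := by positivity
  rw [div_eq_div_iff ha' hb'] at h
  linarith

lemma hasDerivAt_div_one_add {s : ℝ} (hs : 0 < s) :
    HasDerivAt (fun s : ℝ => s / (1 + s)) (1 / (1 + s) ^ 2) s := by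
  convert! (hasDerivAt_id s).div ((hasDerivAt_id s).const_add 1)
    (by simp only [id]; positivity : 1 + id s ≠ 0) using 1
  simp

lemma abs_deriv_smul_beta_integrand {u v s : ℝ} (hs : 0 < s) :
    |1 / (1 + s) ^ 2| • ((s / (1 + s)) ^ (u - 1) * (1 - s / (1 + s)) ^ (v - 1)) =
      s ^ (u - 1) * (1 + s) ^ (-(u + v)) := by
  have h1 : 0 < 1 + s := by positivity
  have h2 : 1 - s / (1 + s) = (1 + s)⁻¹ := by field_simp; ring
  have h3 : 1 / (1 + s) ^ 2 = (1 + s) ^ (-2 : ℝ) := by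
    rw [rpow_neg h1.le, one_div]; norm_cast
  rw [abs_of_pos (by positivity), smul_eq_mul, h2, div_eq_mul_inv s, h3,
    mul_rpow hs.le (inv_pos.2 h1).le, inv_rpow h1.le, inv_rpow h1.le, ← rpow_neg h1.le,
    ← rpow_neg h1.le,
    show -(u + v) = -2 + -(u - 1) + -(v - 1) by ring, rpow_add h1, rpow_add h1]
  ring

lemma integrableOn_rpow_mul_one_add_rpow {u v : ℝ} (hu : 0 < u) (hv : 0 < v) :
    IntegrableOn (fun s : ℝ => s ^ (u - 1) * (1 + s) ^ (-(u + v))) (Set.Ioi 0) := by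
  have h := integrableOn_rpow_mul_one_sub_rpow hu hv
  rw [← image_div_one_add_Ioi, integrableOn_image_iff_integrableOn_abs_deriv_smul
    measurableSet_Ioi (fun s hs => (hasDerivAt_div_one_add hs).hasDerivWithinAt)
    injOn_div_one_add_Ioi] at h
  exact h.congr_fun (fun s hs => abs_deriv_smul_beta_integrand hs) measurableSet_Ioi

lemma integral_rpow_mul_one_add_rpow {u v : ℝ} (hu : 0 < u) (hv : 0 < v) :
    ∫ s in Set.Ioi (0 : ℝ), s ^ (u - 1) * (1 + s) ^ (-(u + v)) = ProbabilityTheory.beta u v := by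
  rw [← integral_rpow_mul_one_sub_rpow hu hv, ← image_div_one_add_Ioi,
    integral_image_eq_integral_abs_deriv_smul measurableSet_Ioi
      (fun s hs => (hasDerivAt_div_one_add hs).hasDerivWithinAt) injOn_div_one_add_Ioi]
  exact setIntegral_congr_fun measurableSet_Ioi fun s hs => (abs_deriv_smul_beta_integrand hs).symm

/-- Tangent line inequality for the convex function `x ↦ x ^ p`. -/
lemma rpow_tangent_le {p m x : ℝ} (hp : 1 ≤ p) (hm : 0 < m) (hx : 0 ≤ x) :
    p * m ^ (p - 1) * x - (p - 1) * m ^ p ≤ x ^ p := by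
  have h := one_add_mul_self_le_rpow_one_add (s := x / m - 1)
    (by linarith [div_nonneg hx hm.le]) hp
  rw [add_sub_cancel, div_rpow hx hm.le, le_div_iff₀ (rpow_pos_of_pos hm p)] at h
  refine le_trans (le_of_eq ?_) h
  rw [rpow_sub_one hm.ne']
  field_simp
  ring

lemma rpow_mul_integral_rpow_le {α β σ : ℝ} (hα : 1 < α) (hβ : 0 < β) (hσ : 0 < σ) :
    σ ^ (-(β * (α - 1))) * (∫ s in Set.Ioc (0 : ℝ) σ, β * s ^ (β - 1) / (1 + s)) ^ α ≤
      ∫ s in Set.Ioc (0 : ℝ) σ, β * (s ^ (β - 1) * (1 + s) ^ (-α)) := by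
  set F := ∫ s in Set.Ioc (0 : ℝ) σ, β * s ^ (β - 1) / (1 + s) with hF
  have hw : IntegrableOn (fun s : ℝ => β * s ^ (β - 1)) (Set.Ioc 0 σ) := by
    have h := intervalIntegral.intervalIntegrable_rpow' (a := 0) (b := σ)
      (by linarith : -1 < β - 1)
    rw [intervalIntegrable_iff_integrableOn_Ioc_of_le hσ.le] at h
    exact h.const_mul β
  have hW : ∫ s in Set.Ioc (0 : ℝ) σ, β * s ^ (β - 1) = σ ^ β := by
    rw [integral_const_mul, ← intervalIntegral.integral_of_le hσ.le,
      integral_rpow (Or.inl (by linarith)), sub_add_cancel, zero_rpow hβ.ne']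
    field_simp
    ring
  have bounded : ∀ q : ℝ, 0 ≤ q →
      IntegrableOn (fun s : ℝ => β * s ^ (β - 1) * (1 + s) ^ (-q)) (Set.Ioc 0 σ) := by
    intro q hq
    refine Integrable.mono hw ?_ ?_
    · exact Measurable.aestronglyMeasurable (by fun_prop)
    · refine (ae_restrict_iff' measurableSet_Ioc).2 (Filter.Eventually.of_forall fun s hs => ?_)
      have h1 : 1 ≤ 1 + s := by linarith [hs.1]
      have h2 : 0 ≤ (1 + s) ^ (-q) := rpow_nonneg (by linarith) _
      rw [norm_mul _ ((1 + s) ^ (-q)), norm_of_nonneg h2]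
      exact mul_le_of_le_one_right (norm_nonneg _)
        (rpow_le_one_of_one_le_of_nonpos h1 (by linarith))
  have hinv : Set.EqOn (fun s : ℝ => β * s ^ (β - 1) * (1 + s) ^ (-1 : ℝ))
      (fun s => β * s ^ (β - 1) / (1 + s)) (Set.Ioc 0 σ) := fun s _ => by
    simp only [rpow_neg_one, div_eq_mul_inv]
  have hFi : IntegrableOn (fun s : ℝ => β * s ^ (β - 1) / (1 + s)) (Set.Ioc 0 σ) :=
    (bounded 1 zero_le_one).congr_fun hinv measurableSet_Ioc
  have hWpos : 0 < σ ^ β := rpow_pos_of_pos hσ β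
  have hFpos : 0 < F := by
    have hge : ∫ s in Set.Ioc (0 : ℝ) σ, β * s ^ (β - 1) * (1 + σ)⁻¹ ≤ F := by
      refine setIntegral_mono_on (hw.mul_const _) hFi measurableSet_Ioc fun s hs => ?_
      have h0 : 0 ≤ β * s ^ (β - 1) := mul_nonneg hβ.le (rpow_nonneg hs.1.le _)
      have h1 : 0 < 1 + s := by linarith [hs.1]
      rw [div_eq_mul_inv]
      gcongr
      exact hs.2
    rw [integral_mul_const, hW] at hge
    exact lt_of_lt_of_le (by positivity) hge
  set m := F / σ ^ β with hm
  have hmpos : 0 < m := by positivity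
  have hint : ∫ s in Set.Ioc (0 : ℝ) σ,
      (α * m ^ (α - 1) * (β * s ^ (β - 1) / (1 + s)) - (α - 1) * m ^ α * (β * s ^ (β - 1))) ≤
      ∫ s in Set.Ioc (0 : ℝ) σ, β * (s ^ (β - 1) * (1 + s) ^ (-α)) := by
    simp_rw [← mul_assoc β]
    refine setIntegral_mono_on ((hFi.const_mul _).sub (hw.const_mul _))
      (bounded α (by linarith)) measurableSet_Ioc fun s hs => ?_
    have h0 : 0 ≤ β * s ^ (β - 1) := mul_nonneg hβ.le (rpow_nonneg hs.1.le _)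
    have h1 : 0 < 1 + s := by linarith [hs.1]
    have h := mul_le_mul_of_nonneg_left (rpow_tangent_le hα.le hmpos (inv_pos.2 h1).le) h0
    rw [inv_rpow h1.le, ← rpow_neg h1.le] at h
    refine le_trans (le_of_eq ?_) h
    ring
  refine le_trans (le_of_eq ?_) hint
  rw [integral_sub (hFi.const_mul _) (hw.const_mul _), integral_const_mul, integral_const_mul, hW,
    ← hF]
  have hFm : F = m * σ ^ β := by rw [hm]; field_simp
  have e : σ ^ (-(β * (α - 1))) * (σ ^ β) ^ α = σ ^ β := by
    rw [← rpow_mul hσ.le, ← rpow_add hσ]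
    congr 1
    ring
  rw [hFm, mul_rpow hmpos.le hWpos.le, rpow_sub_one hmpos.ne']
  calc _ = m ^ α * (σ ^ (-(β * (α - 1))) * (σ ^ β) ^ α) := by ring
    _ = _ := by
      rw [e]
      field_simp
      ring

/-- the constant `k₁(α,β)` is at most `Γ(1+β)Γ(α-β)/Γ(α)`. -/
theorem k1_le_gamma_ratio (α β : ℝ) (hα : 1 < α) (hβ : 0 < β) (hβα : β < α) :
    (⨆ σ : {σ : ℝ // 0 < σ}, (σ : ℝ) ^ (-(β * (α - 1))) *
        (∫ s in Set.Ioc (0 : ℝ) (σ : ℝ), β * s ^ (β - 1) / (1 + s)) ^ α) ≤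
      Real.Gamma (1 + β) * Real.Gamma (α - β) / Real.Gamma α := by
  have : Nonempty {σ : ℝ // 0 < σ} := ⟨⟨1, one_pos⟩⟩
  refine ciSup_le fun ⟨σ, hσ⟩ => (rpow_mul_integral_rpow_le hα hβ hσ).trans ?_
  have hv : 0 < α - β := sub_pos.2 hβα
  have hi := integrableOn_rpow_mul_one_add_rpow hβ hv
  have hb := integral_rpow_mul_one_add_rpow hβ hv
  rw [add_sub_cancel] at hi hb
  calc ∫ s in Set.Ioc (0 : ℝ) σ, β * (s ^ (β - 1) * (1 + s) ^ (-α))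
      ≤ ∫ s in Set.Ioi (0 : ℝ), β * (s ^ (β - 1) * (1 + s) ^ (-α)) := by
        refine setIntegral_mono_set (hi.const_mul β) ?_ Set.Ioc_subset_Ioi_self.eventuallyLE
        refine (ae_restrict_iff' measurableSet_Ioi).2 (Filter.Eventually.of_forall fun s hs => ?_)
        have hs' : 0 < s := hs
        simp only [Pi.zero_apply]
        positivity
    _ = Real.Gamma (1 + β) * Real.Gamma (α - β) / Real.Gamma α := by
        rw [integral_const_mul, hb, ProbabilityTheory.beta, add_sub_cancel, add_comm 1 β,
          Real.Gamma_add_one hβ.ne']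
        ring
end

section
/- Let $0 < \beta < \alpha$ and $t < x$ be real numbers, and let $k_{\alpha,\beta} := \dfrac{\beta^\beta (\alpha-\beta)^{\alpha-\beta}}{\alpha^\alpha}$. Then for every real $u$, $\max(0, u - x)^\beta \le k_{\alpha,\beta}\, \dfrac{\max(0, u - t)^\alpha}{(x-t)^{\alpha-\beta}}$; moreover, equality holds at $u_* := \dfrac{\alpha x - \beta t}{\alpha - \beta}$, so that $k_{\alpha,\beta}$ is the best possible constant in this inequality. -/
open Real

/-- Weighted AM-GM inequality in unnormalized form, with positive real exponents. -/
theorem rpow_mul_rpow_le_const_mul_add_rpow {b c s d : ℝ} (hb : 0 < b) (hc : 0 < c)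
    (hs : 0 ≤ s) (hd : 0 ≤ d) :
    s ^ b * d ^ c ≤ b ^ b * c ^ c / (b + c) ^ (b + c) * (s + d) ^ (b + c) := by
  have hbc : 0 < b + c := by positivity
  have amgm := geom_mean_le_arith_mean2_weighted (w₁ := b / (b + c)) (w₂ := c / (b + c))
    (p₁ := s / b) (p₂ := d / c) (by positivity) (by positivity) (by positivity) (by positivity)
    (by field_simp)
  have mean_eq : b / (b + c) * (s / b) + c / (b + c) * (d / c) = (s + d) / (b + c) := by
    field_simp
  have powered := rpow_le_rpow (by positivity) amgm hbc.le
  rw [mean_eq, mul_rpow (by positivity) (by positivity), ← rpow_mul (by positivity),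
    ← rpow_mul (by positivity), div_mul_cancel₀ _ hbc.ne', div_mul_cancel₀ _ hbc.ne',
    div_rpow hs hb.le, div_rpow hd hc.le, div_rpow (by positivity) hbc.le,
    div_mul_div_comm, div_le_iff₀ (by positivity)] at powered
  exact powered.trans_eq (by ring)

/-- the elementary inequality `(u-x)₊^β ≤ k_{α,β} (u-t)₊^α/(x-t)^{α-β}`,
with equality at `u* = (αx - βt)/(α - β)`, so that `k_{α,β}` is the best constant. -/
theorem pos_part_power_inequality (α β t x : ℝ) (hβ : 0 < β) (hβα : β < α) (htx : t < x) :
    (∀ u : ℝ, (max 0 (u - x)) ^ β ≤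
        β ^ β * (α - β) ^ (α - β) / α ^ α * ((max 0 (u - t)) ^ α / (x - t) ^ (α - β))) ∧
      (max 0 ((α * x - β * t) / (α - β) - x)) ^ β =
        β ^ β * (α - β) ^ (α - β) / α ^ α *
          ((max 0 ((α * x - β * t) / (α - β) - t)) ^ α / (x - t) ^ (α - β)) := by
  have hγ : 0 < α - β := sub_pos.2 hβα
  have hα : 0 < α := hβ.trans hβα
  have hd : 0 < x - t := sub_pos.2 htx
  refine ⟨fun u => ?_, ?_⟩
  · rcases le_or_gt u x with hux | hux
    · rw [max_eq_left (sub_nonpos.2 hux), zero_rpow hβ.ne']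
      positivity
    · have key := rpow_mul_rpow_le_const_mul_add_rpow hβ hγ (sub_pos.2 hux).le hd.le
      rw [add_sub_cancel, sub_add_sub_cancel] at key
      rwa [max_eq_right (sub_pos.2 hux).le, max_eq_right (sub_pos.2 (htx.trans hux)).le,
        ← mul_div_assoc, le_div_iff₀ (by positivity)]
  · have sub_x : (α * x - β * t) / (α - β) - x = β * (x - t) / (α - β) := by
      field_simp
      ring
    have sub_t : (α * x - β * t) / (α - β) - t = α * (x - t) / (α - β) := by
      field_simp
      ring
    have split_rpow {y : ℝ} (hy : 0 < y) : y ^ α = y ^ β * y ^ (α - β) := by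
      rw [← rpow_add hy, add_sub_cancel]
    rw [sub_x, sub_t, max_eq_right (by positivity), max_eq_right (by positivity),
      div_rpow (by positivity) hγ.le, div_rpow (by positivity) hγ.le,
      mul_rpow hβ.le hd.le, mul_rpow hα.le hd.le, split_rpow hd, split_rpow hγ]
    have := (rpow_pos_of_pos hα α).ne'
    have := (rpow_pos_of_pos hγ β).ne'
    have := (rpow_pos_of_pos hγ (α - β)).ne'
    have := (rpow_pos_of_pos hd (α - β)).ne'
    generalize α ^ α = A, (α - β) ^ β = B, (α - β) ^ (α - β) = C, (x - t) ^ (α - β) = D at *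
    field_simp
end

section
/- Let $\alpha > 1$ and $0 < \beta \le \alpha$ be real numbers. Then $k_{1;\alpha,\beta} \le k_{\alpha,\beta}\,\Big(\dfrac{\alpha}{\alpha-1}\Big)^{\alpha}$, where $k_{1;\alpha,\beta} := \sup_{\sigma > 0}\, \sigma^{-\beta(\alpha-1)} \big( \int_0^\sigma \beta s^{\beta-1}(1+s)^{-1}\, ds \big)^{\alpha}$ and $k_{\alpha,\beta} := \beta^\beta (\alpha-\beta)^{\alpha-\beta} / \alpha^\alpha$ (with the convention $0^0 := 1$, so that $k_{\alpha,\alpha} = 1$). -/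
open MeasureTheory Real

/-- The self-power `x ^ x` is positive for `0 ≤ x`, including `0 ^ 0 = 1`. -/
lemma rpow_self_pos {x : ℝ} (hx : 0 ≤ x) : 0 < x ^ x := by
  rcases hx.eq_or_lt with rfl | h
  · simp
  · exact rpow_pos_of_pos h x

/-- Weighted AM-GM in the form `1 / (1 + s) ≤ θ ^ θ (1 - θ) ^ (1 - θ) s ^ (-θ)`. -/
lemma one_div_one_add_le {θ s : ℝ} (hθ : 0 < θ) (hθ1 : θ ≤ 1) (hs : 0 < s) :
    1 / (1 + s) ≤ θ ^ θ * (1 - θ) ^ (1 - θ) * s ^ (-θ) := by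
  have h0 : 0 ≤ 1 - θ := by linarith
  have key := geom_mean_le_arith_mean2_weighted h0 hθ.le
    (one_div_nonneg.2 h0) (div_nonneg hs.le hθ.le) (by ring)
  have h1 : (1 - θ) * (1 / (1 - θ)) ≤ 1 := by
    rw [mul_one_div]
    exact div_self_le_one _
  have h2 : θ * (s / θ) = s := by field_simp
  rw [div_rpow zero_le_one h0, div_rpow hs.le hθ.le, one_rpow, h2] at key
  have hA := rpow_self_pos h0
  have hB := rpow_self_pos hθ.le
  have hS : 0 < s ^ θ := rpow_pos_of_pos hs θ
  have h3 : θ ^ θ * (1 - θ) ^ (1 - θ) * s ^ (-θ) =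
      1 / (1 / (1 - θ) ^ (1 - θ) * (s ^ θ / θ ^ θ)) := by
    rw [rpow_neg hs.le]
    field_simp
  rw [h3]
  exact one_div_le_one_div_of_le (by positivity) (by linarith)

/-- Integrated form of `one_div_one_add_le` against the density `β s ^ (β - 1)`. -/
lemma setIntegral_rpow_div_one_add_le {θ β σ : ℝ} (hθ : 0 < θ) (hθ1 : θ ≤ 1) (hθβ : θ < β)
    (hσ : 0 < σ) :
    ∫ s in Set.Ioc (0 : ℝ) σ, β * s ^ (β - 1) / (1 + s) ≤
      θ ^ θ * (1 - θ) ^ (1 - θ) * (β / (β - θ)) * σ ^ (β - θ) := by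
  have hβ : 0 < β := hθ.trans hθβ
  have hexp : -1 < β - θ - 1 := by linarith
  have hint : IntegrableOn (fun s : ℝ => s ^ (β - θ - 1)) (Set.Ioc 0 σ) :=
    (intervalIntegrable_iff_integrableOn_Ioc_of_le hσ.le).1
      (intervalIntegral.intervalIntegrable_rpow' hexp)
  calc ∫ s in Set.Ioc (0 : ℝ) σ, β * s ^ (β - 1) / (1 + s)
      ≤ ∫ s in Set.Ioc (0 : ℝ) σ, θ ^ θ * (1 - θ) ^ (1 - θ) * β * s ^ (β - θ - 1) := by
        refine integral_mono_of_nonneg ?_ (hint.const_mul _) ?_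
        · filter_upwards [ae_restrict_mem measurableSet_Ioc] with s hs
          have := hs.1
          simp only [Pi.zero_apply]
          positivity
        · filter_upwards [ae_restrict_mem measurableSet_Ioc] with s hs
          have hs0 := hs.1
          have h := mul_le_mul_of_nonneg_left (one_div_one_add_le hθ hθ1 hs0)
            (by positivity : 0 ≤ β * s ^ (β - 1))
          have hadd : s ^ (β - θ - 1) = s ^ (β - 1) * s ^ (-θ) := by
            rw [← rpow_add hs0]
            ring_nf
          rw [hadd]
          calc β * s ^ (β - 1) / (1 + s) = β * s ^ (β - 1) * (1 / (1 + s)) := by ring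
            _ ≤ _ := h
            _ = _ := by ring
    _ = _ := by
        rw [integral_const_mul, ← intervalIntegral.integral_of_le hσ.le,
          integral_rpow (Or.inl hexp), sub_add_cancel, zero_rpow (sub_pos.2 hθβ).ne']
        ring

/-- `k₁(α,β) ≤ k_{α,β} (α/(α-1))^α`.  Here real powers are `Real.rpow`,
so that `0 ^ 0 = 1` and `k_{α,α} = 1`. -/
theorem k1_le_k3 (α β : ℝ) (hα : 1 < α) (hβ : 0 < β) (hβα : β ≤ α) :
    (⨆ σ : {σ : ℝ // 0 < σ}, (σ : ℝ) ^ (-(β * (α - 1))) *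
        (∫ s in Set.Ioc (0 : ℝ) (σ : ℝ), β * s ^ (β - 1) / (1 + s)) ^ α) ≤
      β ^ β * (α - β) ^ (α - β) / α ^ α * (α / (α - 1)) ^ α := by
  have hα0 : 0 < α := by linarith
  have hα1 : 0 < α - 1 := by linarith
  have hαβ : 0 ≤ α - β := by linarith
  have : Nonempty {σ : ℝ // 0 < σ} := ⟨⟨1, one_pos⟩⟩
  refine ciSup_le fun ⟨σ, hσ⟩ => ?_
  have hθ1 : β / α ≤ 1 := (div_le_one hα0).2 hβα
  have h1θ : 1 - β / α = (α - β) / α := by field_simp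
  have hθβ : β / α < β := div_lt_self hβ hα
  have hI := setIntegral_rpow_div_one_add_le (div_pos hβ hα0) hθ1 hθβ hσ
  have hI0 : 0 ≤ ∫ s in Set.Ioc (0 : ℝ) σ, β * s ^ (β - 1) / (1 + s) := by
    refine setIntegral_nonneg measurableSet_Ioc fun s hs => ?_
    have := hs.1
    positivity
  have hfrac : β / (β - β / α) = α / (α - 1) := by
    field_simp
  have hexp : (β - β / α) * α = β * (α - 1) := by
    field_simp
  rw [h1θ, hfrac] at hI
  have hK : ((β / α) ^ (β / α) * ((α - β) / α) ^ ((α - β) / α)) ^ α =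
      β ^ β * (α - β) ^ (α - β) / α ^ α := by
    have hpow : α ^ α = α ^ β * α ^ (α - β) := by
      rw [← rpow_add hα0]
      ring_nf
    rw [mul_rpow (by positivity) (by positivity), ← rpow_mul (by positivity),
      ← rpow_mul (by positivity), div_mul_cancel₀ _ hα0.ne', div_mul_cancel₀ _ hα0.ne',
      div_rpow hβ.le hα0.le, div_rpow hαβ hα0.le, hpow]
    field_simp
  calc σ ^ (-(β * (α - 1))) * (∫ s in Set.Ioc (0 : ℝ) σ, β * s ^ (β - 1) / (1 + s)) ^ α
      ≤ σ ^ (-(β * (α - 1))) * ((β / α) ^ (β / α) * ((α - β) / α) ^ ((α - β) / α) *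
          (α / (α - 1)) * σ ^ (β - β / α)) ^ α := by gcongr
    _ = _ := by
        rw [mul_rpow (by positivity) (by positivity), mul_rpow (by positivity) (by positivity),
          hK, ← rpow_mul hσ.le, hexp, mul_left_comm, ← rpow_add hσ, neg_add_cancel, rpow_zero,
          mul_one]
end

section
/- Let $\alpha > 1$ be a real number. Then $k_{1;\alpha,\alpha} = \Big(\dfrac{\alpha}{\alpha-1}\Big)^{\alpha}$; that is, $\sup_{\sigma > 0}\, \sigma^{-\alpha(\alpha-1)} \Big( \int_0^\sigma \dfrac{\alpha s^{\alpha-1}}{1+s}\, ds \Big)^{\alpha} = \Big(\dfrac{\alpha}{\alpha-1}\Big)^{\alpha}$. -/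
open MeasureTheory Real

lemma integrableOn_Ioc_rpow_sub_two {α : ℝ} (hα : 1 < α) {σ : ℝ} (hσ : 0 ≤ σ) :
    IntegrableOn (fun s : ℝ => α * s ^ (α - 2)) (Set.Ioc 0 σ) := by
  have h := intervalIntegral.intervalIntegrable_rpow' (a := 0) (b := σ) (r := α - 2) (by linarith)
  exact ((intervalIntegrable_iff_integrableOn_Ioc_of_le hσ).1 h).const_mul α

lemma setIntegral_Ioc_rpow_sub_two {α : ℝ} (hα : 1 < α) {a b : ℝ} (hab : a ≤ b) :
    ∫ s in Set.Ioc a b, α * s ^ (α - 2) =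
      α / (α - 1) * (b ^ (α - 1) - a ^ (α - 1)) := by
  rw [← intervalIntegral.integral_of_le hab, intervalIntegral.integral_const_mul,
    integral_rpow (Or.inl (by linarith)), show α - 2 + 1 = α - 1 by ring]
  ring

lemma rpow_sub_one_div_le {α s : ℝ} (hα : 1 < α) (hs : 0 < s) :
    α * s ^ (α - 1) / (1 + s) ≤ α * s ^ (α - 2) := by
  rw [div_le_iff₀ (by linarith), show α - 1 = α - 2 + 1 by ring, rpow_add_one hs.ne']
  have : 0 < α * s ^ (α - 2) := by positivity
  nlinarith

lemma le_rpow_sub_one_div {α M s : ℝ} (hα : 1 < α) (hM : 0 < M) (hs : M ≤ s) :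
    M / (1 + M) * (α * s ^ (α - 2)) ≤ α * s ^ (α - 1) / (1 + s) := by
  have hs0 : 0 < s := hM.trans_le hs
  have h : M / (1 + M) ≤ s / (1 + s) := by
    rw [div_le_div_iff₀ (by linarith) (by linarith)]
    linarith
  calc M / (1 + M) * (α * s ^ (α - 2)) ≤ s / (1 + s) * (α * s ^ (α - 2)) := by gcongr
    _ = α * s ^ (α - 1) / (1 + s) := by
      rw [show α - 1 = α - 2 + 1 by ring, rpow_add_one hs0.ne']
      ring

lemma integrableOn_Ioc_rpow_sub_one_div {α : ℝ} (hα : 1 < α) {σ : ℝ} (hσ : 0 ≤ σ) :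
    IntegrableOn (fun s : ℝ => α * s ^ (α - 1) / (1 + s)) (Set.Ioc 0 σ) := by
  refine Integrable.mono' (integrableOn_Ioc_rpow_sub_two hα hσ)
    (Measurable.aestronglyMeasurable (by fun_prop)) ?_
  refine (ae_restrict_iff' measurableSet_Ioc).2 (ae_of_all _ fun s hs => ?_)
  have hs0 : 0 < s := hs.1
  rw [norm_of_nonneg (by positivity)]
  exact rpow_sub_one_div_le hα hs0

lemma setIntegral_rpow_sub_one_div_nonneg {α : ℝ} (hα : 1 < α) (σ : ℝ) :
    0 ≤ ∫ s in Set.Ioc (0 : ℝ) σ, α * s ^ (α - 1) / (1 + s) := by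
  refine setIntegral_nonneg measurableSet_Ioc fun s hs => ?_
  have hs0 : 0 < s := hs.1
  positivity

lemma setIntegral_rpow_sub_one_div_le {α : ℝ} (hα : 1 < α) {σ : ℝ} (hσ : 0 < σ) :
    ∫ s in Set.Ioc (0 : ℝ) σ, α * s ^ (α - 1) / (1 + s) ≤ α / (α - 1) * σ ^ (α - 1) := by
  calc _ ≤ ∫ s in Set.Ioc (0 : ℝ) σ, α * s ^ (α - 2) :=
        setIntegral_mono_on (integrableOn_Ioc_rpow_sub_one_div hα hσ.le)
          (integrableOn_Ioc_rpow_sub_two hα hσ.le) measurableSet_Ioc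
          fun s hs => rpow_sub_one_div_le hα hs.1
    _ = _ := by
      rw [setIntegral_Ioc_rpow_sub_two hα hσ.le, zero_rpow (by linarith), sub_zero]

lemma le_setIntegral_rpow_sub_one_div {α : ℝ} (hα : 1 < α) {M σ : ℝ} (hM : 0 < M) (hσ : M ≤ σ) :
    M / (1 + M) * (α / (α - 1) * (σ ^ (α - 1) - M ^ (α - 1))) ≤
      ∫ s in Set.Ioc (0 : ℝ) σ, α * s ^ (α - 1) / (1 + s) := by
  have hσ0 : 0 ≤ σ := hM.le.trans hσ
  have hsub : Set.Ioc M σ ⊆ Set.Ioc 0 σ := Set.Ioc_subset_Ioc_left hM.le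
  have hint := integrableOn_Ioc_rpow_sub_one_div hα hσ0
  rw [← setIntegral_Ioc_rpow_sub_two hα hσ, ← integral_const_mul]
  calc _ ≤ ∫ s in Set.Ioc M σ, α * s ^ (α - 1) / (1 + s) :=
        setIntegral_mono_on (((integrableOn_Ioc_rpow_sub_two hα hσ0).mono_set hsub).const_mul _)
          (hint.mono_set hsub) measurableSet_Ioc
          fun s hs => le_rpow_sub_one_div hα hM hs.1.le
    _ ≤ _ := by
      refine setIntegral_mono_set hint ?_ hsub.eventuallyLE
      refine (ae_restrict_iff' measurableSet_Ioc).2 (ae_of_all _ fun s hs => ?_)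
      have hs0 : 0 < s := hs.1
      simp only [Pi.zero_apply]
      positivity

lemma rpow_neg_mul_mul_rpow {α σ x : ℝ} (hσ : 0 < σ) (hx : 0 ≤ x) :
    σ ^ (-(α * (α - 1))) * x ^ α = (σ ^ (-(α - 1)) * x) ^ α := by
  rw [mul_rpow (by positivity) hx, ← rpow_mul hσ.le]
  congr 2
  ring

lemma tendsto_lower_bound {α : ℝ} (hα : 1 < α) :
    Filter.Tendsto
      (fun M : ℝ => (M / (1 + M) * (α / (α - 1) * (1 - M ^ (-(α - 1))))) ^ α)
      Filter.atTop (nhds ((α / (α - 1)) ^ α)) := by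
  have h₁ : Filter.Tendsto (fun M : ℝ => M / (1 + M)) Filter.atTop (nhds 1) := by
    have h : Filter.Tendsto (fun M : ℝ => 1 - (1 + M)⁻¹) Filter.atTop (nhds (1 - 0)) :=
      tendsto_const_nhds.sub
        (tendsto_inv_atTop_zero.comp (Filter.tendsto_atTop_add_const_left _ 1 Filter.tendsto_id))
    rw [sub_zero] at h
    refine h.congr' ?_
    filter_upwards [Filter.eventually_gt_atTop 0] with M hM
    field_simp
    ring
  have h₂ := tendsto_rpow_neg_atTop (y := α - 1) (by linarith)
  have h := (h₁.mul ((h₂.const_sub 1).const_mul (α / (α - 1)))).rpow_const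
    (p := α) (Or.inr (by linarith))
  simpa using h

/-- `k₁(α,α) = (α/(α-1))^α`. -/
theorem k1_eq_k3_at_alpha (α : ℝ) (hα : 1 < α) :
    (⨆ σ : {σ : ℝ // 0 < σ}, (σ : ℝ) ^ (-(α * (α - 1))) *
        (∫ s in Set.Ioc (0 : ℝ) (σ : ℝ), α * s ^ (α - 1) / (1 + s)) ^ α) =
      (α / (α - 1)) ^ α := by
  have hα₁ : 0 < α - 1 := by linarith
  have upper (σ : {σ : ℝ // 0 < σ}) : (σ : ℝ) ^ (-(α * (α - 1))) *
      (∫ s in Set.Ioc (0 : ℝ) (σ : ℝ), α * s ^ (α - 1) / (1 + s)) ^ α ≤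
        (α / (α - 1)) ^ α := by
    obtain ⟨σ, hσ⟩ := σ
    have hnonneg := setIntegral_rpow_sub_one_div_nonneg hα σ
    rw [rpow_neg_mul_mul_rpow hσ hnonneg]
    refine rpow_le_rpow (by positivity) ?_ (by linarith)
    rw [rpow_neg hσ.le, inv_mul_le_iff₀ (by positivity), mul_comm]
    exact setIntegral_rpow_sub_one_div_le hα hσ
  have : Nonempty {σ : ℝ // 0 < σ} := ⟨⟨1, one_pos⟩⟩
  refine le_antisymm (ciSup_le upper) (le_of_tendsto (tendsto_lower_bound hα) ?_)
  filter_upwards [Filter.eventually_ge_atTop 1] with M hM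
  have hM₀ : 0 < M := by linarith
  have hσ : 0 < M ^ 2 := by positivity
  refine le_trans ?_ (le_ciSup ⟨_, Set.forall_mem_range.2 upper⟩ ⟨M ^ 2, hσ⟩)
  rw [rpow_neg_mul_mul_rpow hσ (setIntegral_rpow_sub_one_div_nonneg hα _)]
  have hle : M ^ (-(α - 1)) ≤ 1 := rpow_le_one_of_one_le_of_nonpos hM (by linarith)
  have hsub : 0 ≤ 1 - M ^ (-(α - 1)) := by linarith
  refine rpow_le_rpow (by positivity) ?_ (by linarith)
  rw [rpow_neg hσ.le, le_inv_mul_iff₀ (by positivity)]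
  refine le_trans (le_of_eq ?_)
    (le_setIntegral_rpow_sub_one_div hα hM₀ (by nlinarith : M ≤ M ^ 2))
  have hsq : (M ^ 2) ^ (α - 1) = M ^ (α - 1) * M ^ (α - 1) := by
    rw [pow_two, mul_rpow hM₀.le hM₀.le]
  have hpos : 0 < M ^ (α - 1) := by positivity
  rw [hsq, rpow_neg hM₀.le]
  field_simp
end

section
/- Let $X$ be a real-valued random variable and $c \le 0 \le d$ real constants with $\mathsf{E} X = 0$ and $c \le X \le d$ almost surely, and let $s > 0$ be a real number with $d - c \le 2 s$. Then for every real $t$, $\mathsf{E}\,\max(0, X - t)^5 \le \mathsf{E}\,\max(0, s Z - t)^5$, where $Z$ is a standard normal random variable. -/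
open MeasureTheory ProbabilityTheory Real

lemma integrable_pow_gaussianReal (m : ℝ) (v : NNReal) (k : ℕ) :
    Integrable (fun z : ℝ => z ^ k) (gaussianReal m v) := by
  rcases eq_or_ne k 0 with rfl | hk
  · simp
  · have h := (memLp_id_gaussianReal' (μ := m) (v := v) (k : ENNReal)
      (by simp)).integrable_norm_pow hk
    refine h.mono (by fun_prop) (Filter.Eventually.of_forall fun z => ?_)
    simp

lemma integrable_posPart_pow_gaussianReal (m : ℝ) (v : NNReal) {k : ℕ} (hk : k ≠ 0) :
    Integrable (fun z : ℝ => max 0 z ^ k) (gaussianReal m v) := by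
  refine (integrable_pow_gaussianReal m v k).mono (by fun_prop)
    (Filter.Eventually.of_forall fun z => ?_)
  rcases le_total 0 z with h | h
  · simp [h]
  · simp [h, hk]

lemma integral_posPart_pow_gaussianReal {k : ℕ} (hk : k ≠ 0) :
    ∫ z, max 0 z ^ k ∂gaussianReal 0 1 =
      (√(2 * π))⁻¹ * ((1 / 2 : ℝ) ^ (-((k : ℝ) + 1) / 2) * (1 / 2) *
        Gamma (((k : ℝ) + 1) / 2)) := by
  rw [integral_gaussianReal_eq_integral_smul (by norm_num),
    ← integral_rpow_mul_exp_neg_mul_rpow (by norm_num)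
      (by have : (0 : ℝ) ≤ k := k.cast_nonneg
          linarith) (by norm_num), ← integral_const_mul,
    ← integral_indicator measurableSet_Ioi]
  congr 1 with z
  by_cases hz : 0 < z
  · have h : z ^ (2 : ℝ) = z ^ 2 := by exact_mod_cast rpow_natCast z 2
    simp only [gaussianPDFReal_def, smul_eq_mul, Set.indicator, Set.mem_Ioi, hz, if_true,
      max_eq_right hz.le, rpow_natCast, h, NNReal.coe_one, mul_one, sub_zero]
    ring_nf
  · simp [Set.indicator, hz, max_eq_left (not_lt.1 hz), hk]

lemma one_half_rpow_neg_add_half (n : ℕ) :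
    (1 / 2 : ℝ) ^ (-((n : ℝ) + 1 / 2)) = 2 ^ n * √2 := by
  rw [one_div, inv_rpow two_pos.le, rpow_neg two_pos.le, inv_inv, rpow_add two_pos,
    rpow_natCast, sqrt_eq_rpow, one_div]

lemma integral_posPart_even_pow_gaussianReal {n : ℕ} (hn : n ≠ 0) :
    ∫ z, max 0 z ^ (2 * n) ∂gaussianReal 0 1 = (Nat.doubleFactorial (2 * n - 1) : ℝ) / 2 := by
  rw [integral_posPart_pow_gaussianReal (by positivity)]
  have h1 : -(((2 * n : ℕ) : ℝ) + 1) / 2 = -((n : ℝ) + 1 / 2) := by push_cast; ring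
  have h2 : (((2 * n : ℕ) : ℝ) + 1) / 2 = n + 1 / 2 := by push_cast; ring
  have hs : √π ≠ 0 := by positivity
  rw [h1, h2, one_half_rpow_neg_add_half, Gamma_nat_add_half, sqrt_mul two_pos.le]
  field_simp

lemma three_le_integral_posPart_pow_five_gaussianReal :
    3 ≤ ∫ z, max 0 z ^ 5 ∂gaussianReal 0 1 := by
  rw [integral_posPart_pow_gaussianReal (by norm_num)]
  have h1 : Gamma (((5 : ℕ) + 1) / 2 : ℝ) = 2 := by
    rw [show (((5 : ℕ) + 1) / 2 : ℝ) = (2 : ℕ) + 1 by norm_num, Gamma_nat_eq_factorial]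
    norm_num
  have h2 : (1 / 2 : ℝ) ^ (-(((5 : ℕ) : ℝ) + 1) / 2) = 8 := by
    rw [show -(((5 : ℕ) : ℝ) + 1) / 2 = -((3 : ℕ) : ℝ) by norm_num, rpow_neg (by norm_num),
      rpow_natCast]
    norm_num
  have h3 : √(2 * π) ≤ 8 / 3 := by
    rw [sqrt_le_left (by norm_num)]
    linarith [pi_lt_d2]
  have h4 : 0 < √(2 * π) := by positivity
  rw [h1, h2, inv_mul_eq_div, le_div_iff₀ h4]
  linarith

lemma integral_pow_gaussianReal_eq_posPart {k : ℕ} (hk : k ≠ 0) :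
    ∫ z, z ^ k ∂gaussianReal 0 1 = (1 + (-1) ^ k) * ∫ z, max 0 z ^ k ∂gaussianReal 0 1 := by
  have hneg : Measure.map (fun z : ℝ => -z) (gaussianReal 0 1) = gaussianReal 0 1 := by
    simpa using gaussianReal_map_neg (μ := 0) (v := 1)
  have hmp : MeasurePreserving (fun z : ℝ => -z) (gaussianReal 0 1) (gaussianReal 0 1) :=
    ⟨measurable_neg, hneg⟩
  have hI := integrable_posPart_pow_gaussianReal 0 1 hk
  have hsymm : ∫ z, max 0 (-z) ^ k ∂gaussianReal 0 1 = ∫ z, max 0 z ^ k ∂gaussianReal 0 1 :=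
    hmp.integral_comp (MeasurableEquiv.neg ℝ).measurableEmbedding (fun z => max 0 z ^ k)
  have hI' : Integrable (fun z : ℝ => max 0 (-z) ^ k) (gaussianReal 0 1) :=
    hmp.integrable_comp_of_integrable hI
  have hsplit (z : ℝ) : z ^ k = max 0 z ^ k + (-1) ^ k * max 0 (-z) ^ k := by
    rw [← mul_pow]
    rcases le_total 0 z with h | h
    · simp [h, hk]
    · simp [h, hk]
  rw [funext hsplit]
  rw [integral_add hI (hI'.const_mul _), integral_const_mul, hsymm]
  ring

lemma integral_add_pow_five_gaussianReal (u : ℝ) :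
    ∫ z, (z + u) ^ 5 ∂gaussianReal 0 1 = u ^ 5 + 10 * u ^ 3 + 15 * u := by
  have h2 := integral_posPart_even_pow_gaussianReal (n := 1) (by norm_num)
  have h4 := integral_posPart_even_pow_gaussianReal (n := 2) (by norm_num)
  norm_num [Nat.doubleFactorial] at h2 h4
  have hI (k : ℕ) := integrable_pow_gaussianReal 0 1 k
  have hexp (z : ℝ) : (z + u) ^ 5 =
      ∑ k ∈ Finset.range 6, z ^ k * (u ^ (5 - k) * Nat.choose 5 k) := by
    rw [add_pow]; simp [mul_assoc]
  rw [funext hexp]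
  rw [integral_finsetSum _ fun k _ => (hI k).mul_const _]
  simp_rw [integral_mul_const]
  simp only [Finset.sum_range_succ, Finset.sum_range_zero]
  rw [integral_pow_gaussianReal_eq_posPart (k := 1) (by norm_num),
   integral_pow_gaussianReal_eq_posPart (k := 2) (by norm_num),
   integral_pow_gaussianReal_eq_posPart (k := 3) (by norm_num),
   integral_pow_gaussianReal_eq_posPart (k := 4) (by norm_num),
   integral_pow_gaussianReal_eq_posPart (k := 5) (by norm_num), h2, h4]
  norm_num [Nat.choose]
  ring

lemma integrable_posPart_sub_pow_gaussianReal (m : ℝ) (v : NNReal) (t : ℝ) {k : ℕ} (hk : k ≠ 0) :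
    Integrable (fun z : ℝ => max 0 (z - t) ^ k) (gaussianReal m v) := by
  have hmp : MeasurePreserving (fun z : ℝ => z - t) (gaussianReal m v) (gaussianReal (m - t) v) :=
    ⟨by fun_prop, gaussianReal_map_sub_const t⟩
  exact hmp.integrable_comp_of_integrable (integrable_posPart_pow_gaussianReal (m - t) v hk)

lemma le_integral_posPart_sub_pow_five_gaussianReal (u : ℝ) :
    u ^ 5 + 10 * u ^ 3 + 15 * u ≤ ∫ z, max 0 (z - -u) ^ 5 ∂gaussianReal 0 1 := by
  rw [← integral_add_pow_five_gaussianReal]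
  have hmp : MeasurePreserving (fun z : ℝ => z + u) (gaussianReal 0 1) (gaussianReal (0 + u) 1) :=
    ⟨by fun_prop, gaussianReal_map_add_const u⟩
  refine integral_mono (hmp.integrable_comp_of_integrable (integrable_pow_gaussianReal _ 1 5))
    (integrable_posPart_sub_pow_gaussianReal 0 1 (-u) (by norm_num)) fun z => ?_
  rw [sub_neg_eq_add]
  exact Odd.strictMono_pow (by decide) |>.monotone (le_max_right _ _)

lemma mul_pow_four_sub_pow_five_le_pow_five {x y : ℝ} (hx : 0 ≤ x) (hy : 0 ≤ y) :
    5 * x * y ^ 4 - 4 * y ^ 5 ≤ x ^ 5 := by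
  have : 0 ≤ (x - y) ^ 2 * (x ^ 3 + 2 * x ^ 2 * y + 3 * x * y ^ 2 + 4 * y ^ 3) := by positivity
  linarith

lemma mul_pow_five_le_integral_posPart_sub_gaussianReal {t : ℝ} (ht : -(1 / 2) ≤ t) (ht' : t ≤ 2) :
    3 * (1 - t / 2) ^ 5 ≤ ∫ z, max 0 (z - t) ^ 5 ∂gaussianReal 0 1 := by
  obtain ⟨l, rfl⟩ : ∃ l, t = 2 - 2 * l := ⟨1 - t / 2, by ring⟩
  have hl : 0 ≤ l := by linarith
  have h4 := integral_posPart_even_pow_gaussianReal (n := 2) (by norm_num)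
  norm_num [Nat.doubleFactorial] at h4
  have h5 := three_le_integral_posPart_pow_five_gaussianReal
  have hI4 := integrable_posPart_pow_gaussianReal 0 1 (k := 4) (by norm_num)
  have hI5 := integrable_posPart_pow_gaussianReal 0 1 (k := 5) (by norm_num)
  have hmono : ∫ z, ((5 * l ^ 4 - 4 * l ^ 5) * max 0 z ^ 5 - 5 * l ^ 4 * (2 - 2 * l) * max 0 z ^ 4)
      ∂gaussianReal 0 1 ≤ ∫ z, max 0 (z - (2 - 2 * l)) ^ 5 ∂gaussianReal 0 1 := by
    refine integral_mono ((hI5.const_mul _).sub (hI4.const_mul _))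
      (integrable_posPart_sub_pow_gaussianReal 0 1 _ (by norm_num)) fun z => ?_
    have hy := mul_pow_four_sub_pow_five_le_pow_five (le_max_left 0 (z - (2 - 2 * l)))
      (mul_nonneg hl (le_max_left 0 z))
    refine le_trans ?_ hy
    have hz : (z - (2 - 2 * l)) * max 0 z ^ 4 ≤ max 0 (z - (2 - 2 * l)) * max 0 z ^ 4 := by
      gcongr; exact le_max_right _ _
    have hzz : z * max 0 z ^ 4 = max 0 z ^ 5 := by
      rcases le_total 0 z with h | h <;> simp [h]; ring
    have := mul_le_mul_of_nonneg_left hz (pow_nonneg hl 4)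
    linear_combination 5 * this - 5 * l ^ 4 * hzz
  rw [integral_sub (hI5.const_mul _) (hI4.const_mul _), integral_const_mul, integral_const_mul,
    h4] at hmono
  refine le_trans ?_ hmono
  have := mul_nonneg (mul_nonneg (pow_nonneg hl 4) (by linarith : 0 ≤ 5 - 4 * l)) (sub_nonneg.2 h5)
  linear_combination this

/-- Nonnegativity of `E (Z + u) ^ 5 - E (X + u) ^ 5`, where `X` is the centred variable with values
`-(1 - δ)` and `1 + δ`. -/
lemma fifth_moment_gap_asymm {δ u : ℝ} (h0 : 0 ≤ δ) (h1 : δ ≤ 1) (hu : 1 - δ ≤ u)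
    (hu' : 2 / 5 ≤ u) :
    4 * δ * (1 - δ ^ 4) ≤
      10 * u * (δ * u - (1 - δ ^ 2)) ^ 2 + u * (10 * δ ^ 2 + 5 * δ ^ 4) := by
  have hu0 : 0 ≤ u := by linarith
  have hsq : 0 ≤ u * (δ * u - (1 - δ ^ 2)) ^ 2 := by positivity
  rcases le_total (2 / 5) (δ * u) with h | h
  · nlinarith [pow_nonneg h0 5, mul_nonneg h0 (sub_nonneg.2 h), mul_nonneg (pow_nonneg h0 4) hu0]
  rcases le_total δ (1 / 2) with h3 | h3
  · have e1 : 4 * δ * (1 - δ ^ 4) ≤ u * (4 * δ * (1 + δ) * (1 + δ ^ 2)) := by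
      have : 0 ≤ 4 * δ * (1 + δ) * (1 + δ ^ 2) := by positivity
      nlinarith
    have e2 : (3 / 5 - δ ^ 2) ^ 2 ≤ (δ * u - (1 - δ ^ 2)) ^ 2 := by
      have : 3 / 5 - δ ^ 2 ≤ 1 - δ ^ 2 - δ * u := by linarith
      have h4 : 0 ≤ 3 / 5 - δ ^ 2 := by nlinarith
      nlinarith
    have e3 : 4 * δ * (1 + δ) * (1 + δ ^ 2) ≤
        10 * (3 / 5 - δ ^ 2) ^ 2 + (10 * δ ^ 2 + 5 * δ ^ 4) := by
      nlinarith [pow_nonneg h0 3, pow_nonneg h0 4, mul_nonneg h0 (sub_nonneg.2 h3),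
        mul_nonneg (pow_nonneg h0 2) (sub_nonneg.2 h3)]
    nlinarith [mul_le_mul_of_nonneg_left e3 hu0, mul_le_mul_of_nonneg_left e2 hu0]
  rcases le_total δ (3 / 5) with h4 | h4
  · have hd : 4 * δ * (1 - δ ^ 4) ≤ 4 * δ - 1 / 4 * δ := by
      nlinarith [pow_le_pow_left₀ (by norm_num : (0 : ℝ) ≤ 1 / 2) h3 4]
    nlinarith [mul_nonneg hu0 (sq_nonneg (1 - δ ^ 2 - δ * u - 35 / 100)),
      mul_nonneg (sub_nonneg.2 h3) (sub_nonneg.2 h4), mul_nonneg (sub_nonneg.2 hu) (sub_nonneg.2 h),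
      mul_nonneg (sub_nonneg.2 hu) (sub_nonneg.2 h4),
      mul_nonneg (sub_nonneg.2 hu) (sub_nonneg.2 h3), pow_nonneg h0 4, pow_nonneg h0 3]
  rcases le_total 4 (u * (10 * δ + 5 * δ ^ 3)) with h5 | h5
  · nlinarith [pow_nonneg h0 5]
  · nlinarith [mul_nonneg h0 (sub_nonneg.2 hu), pow_nonneg h0 3]

lemma mul_pow_five_le_add_pow_six {a p : ℝ} (ha : 0 ≤ a) (hp : 0 ≤ p) :
    46656 * (a * p ^ 5) ≤ 3125 * (a + p) ^ 6 := by
  have : 0 ≤ (p - 5 * a) ^ 2 * (1296 * p ^ 4 + 864 * p ^ 3 * (a + p) + 540 * p ^ 2 * (a + p) ^ 2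
     + 300 * p * (a + p) ^ 3 + 125 * (a + p) ^ 4) := by positivity
  linarith

lemma twoPoint_fifth_moment_le {a u : ℝ} (h0 : 0 ≤ a) (h1 : a ≤ 2) (hu : a ≤ u) (hu' : 2 / 5 ≤ u) :
    a * (2 - a + u) ^ 5 / 2 + (2 - a) * (u - a) ^ 5 / 2 ≤ u ^ 5 + 10 * u ^ 3 + 15 * u := by
  rcases le_total a 1 with h | h
  · have := fifth_moment_gap_asymm (δ := 1 - a) (u := u) (by linarith) (by linarith)
      (by linarith) hu'
    linarith
  · have : 0 ≤ (a - 1) ^ 2 * u ^ 3 * 10 + (a - 1) * (a * (2 - a)) * u ^ 2 * 20 +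
      u * (10 - 10 * (a - 1) ^ 2 + 15 * (a - 1) ^ 4)
      + 4 * (a - 1) * (a * (2 - a)) * (1 + (a - 1) ^ 2) := by
      have := sub_nonneg.2 h
      have := sub_nonneg.2 h1
      have : 0 ≤ 10 - 10 * (a - 1) ^ 2 + 15 * (a - 1) ^ 4 := by nlinarith [sq_nonneg ((a - 1) ^ 2 - 1)]
      have : 0 ≤ u := by linarith
      positivity
    linarith

lemma mul_pow_five_le_of_le {a u : ℝ} (hu : u ≤ a) (hu' : 2 / 5 ≤ u) (hau : a ≤ 2 + u) :
    a * (2 - a + u) ^ 5 ≤ 32 * u := by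
  obtain ⟨h, rfl⟩ : ∃ h, a = u + 2 * h := ⟨(a - u) / 2, by ring⟩
  have h0 : 0 ≤ h := by linarith
  have h1 : 0 ≤ 1 - h := by linarith
  have hb : (1 - h) ^ 5 * (1 + 5 * h) ≤ 1 := by
    have := one_add_mul_le_pow (show (-2 : ℝ) ≤ h by linarith) 5
    calc _ ≤ (1 - h) ^ 5 * (1 + h) ^ 5 := by gcongr; push_cast at this; linarith
      _ = (1 - h ^ 2) ^ 5 := by ring
      _ ≤ 1 := pow_le_one₀ (by nlinarith) (by nlinarith)
  calc _ = 32 * ((1 - h) ^ 5 * (u + 2 * h)) := by ring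
    _ ≤ 32 * ((1 - h) ^ 5 * (u * (1 + 5 * h))) := by gcongr; nlinarith
    _ = 32 * (u * ((1 - h) ^ 5 * (1 + 5 * h))) := by ring
    _ ≤ 32 * (u * 1) := by gcongr
    _ = _ := by ring

lemma twoPoint_posPart_pow_five_le {a t : ℝ} (h0 : 0 ≤ a) (ht : -(2 / 5) ≤ t) (hta : t ≤ 2 - a) :
    a * max 0 (2 - a - t) ^ 5 / 2 + (2 - a) * max 0 (-a - t) ^ 5 / 2 ≤ 3 * (1 - t / 2) ^ 5 := by
  have hp : 0 ≤ 2 - a - t := by linarith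
  have h2 := mul_pow_five_le_add_pow_six h0 hp
  have h3 : (a + (2 - a - t)) ^ 6 ≤ 384 / 5 * (1 - t / 2) ^ 5 := by
    have : 0 ≤ (1 - t / 2) ^ 5 := pow_nonneg (by linarith) 5
    linear_combination 64 * mul_nonneg (by linarith : 0 ≤ 6 / 5 - (1 - t / 2)) this
  rw [max_eq_right hp]
  rcases le_total 0 (-a - t) with h | h
  · have h4 : (-a - t) ^ 5 ≤ (2 / 5) ^ 5 := pow_le_pow_left₀ h (by linarith) 5
    have h5 : (1 : ℝ) ≤ (1 - t / 2) ^ 5 := one_le_pow₀ (by linarith)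
    have h6 : (2 - a) * (-a - t) ^ 5 ≤ 2 * (-a - t) ^ 5 := by gcongr; linarith
    rw [max_eq_right h]
    linarith
  · have : 0 ≤ (1 - t / 2) ^ 5 := pow_nonneg (by linarith) 5
    rw [max_eq_left h]
    linarith

/-- Comparison for the centred variable with values `-a` and `2 - a`. -/
lemma twoPoint_le {a : ℝ} (h0 : 0 ≤ a) (h1 : a ≤ 2) (t : ℝ) :
    a * max 0 (2 - a - t) ^ 5 / 2 + (2 - a) * max 0 (-a - t) ^ 5 / 2 ≤
      ∫ z, max 0 (z - t) ^ 5 ∂gaussianReal 0 1 := by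
  rcases le_total (2 - a) t with h2 | h2
  · rw [max_eq_left (by linarith : 2 - a - t ≤ 0), max_eq_left (by linarith : -a - t ≤ 0)]
    simp only [ne_eq, OfNat.ofNat_ne_zero, not_false_eq_true, zero_pow, mul_zero, zero_div,
      add_zero]
    exact integral_nonneg fun z => by positivity
  rcases le_total (-(2 / 5)) t with h3 | h3
  · exact (twoPoint_posPart_pow_five_le h0 h3 h2).trans
      (mul_pow_five_le_integral_posPart_sub_gaussianReal (by linarith) (by linarith))
  obtain ⟨u, rfl⟩ : ∃ u, t = -u := ⟨-t, by ring⟩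
  refine le_trans ?_ (le_integral_posPart_sub_pow_five_gaussianReal u)
  have hu : 2 / 5 ≤ u := by linarith
  rw [max_eq_right (by linarith : 0 ≤ 2 - a - -u)]
  rcases le_total a u with h4 | h4
  · rw [max_eq_right (by linarith : 0 ≤ -a - -u)]
    have := twoPoint_fifth_moment_le h0 h1 h4 hu
    rwa [sub_neg_eq_add, sub_neg_eq_add, neg_add_eq_sub]
  · rw [max_eq_left (by linarith : -a - -u ≤ 0)]
    have := mul_pow_five_le_of_le h4 hu (by linarith)
    have : 0 ≤ u * (u ^ 2 - 4 / 25) * (u ^ 2 + 11) := by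
      have : 0 ≤ u ^ 2 - 4 / 25 := by nlinarith
      positivity
    have : 0 ≤ u ^ 3 := by positivity
    rw [sub_neg_eq_add]
    nlinarith

lemma convexOn_posPart_sub_pow (t : ℝ) (k : ℕ) :
    ConvexOn ℝ Set.univ fun x : ℝ => max 0 (x - t) ^ k := by
  refine ConvexOn.pow ?_ (fun x _ => le_max_left _ _) k
  exact (convexOn_const 0 convex_univ).sup
    (ConvexOn.sub (convexOn_id convex_univ) (concaveOn_const t convex_univ))

/-- moment comparison for a single mean-zero bounded random variable. -/
theorem single_variable_moment_comparison
    {Ω : Type*} {m0 : MeasurableSpace Ω} {μ : Measure Ω} [IsProbabilityMeasure μ]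
    (X : Ω → ℝ) (hInt : Integrable X μ) (c d : ℝ) (hc : c ≤ 0) (hd : 0 ≤ d)
    (hEX : ∫ ω, X ω ∂μ = 0) (hb : ∀ᵐ ω ∂μ, c ≤ X ω ∧ X ω ≤ d)
    (s : ℝ) (hs : 0 < s) (hds : d - c ≤ 2 * s) (t : ℝ) :
    ∫ ω, max 0 (X ω - t) ^ 5 ∂μ ≤
      ∫ z, max 0 (s * z - t) ^ 5 ∂(gaussianReal 0 1) := by
  set f : ℝ → ℝ := fun x => max 0 (x - t) ^ 5 with hf
  have hchord : ∀ᵐ ω ∂μ, f (X ω) ≤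
      (c + 2 * s - X ω) * (f c / (2 * s)) + (X ω - c) * (f (c + 2 * s) / (2 * s)) := by
    filter_upwards [hb] with ω hω
    have hconv := @(convexOn_posPart_sub_pow t 5).2 c (Set.mem_univ c) (c + 2 * s) (Set.mem_univ _)
      ((c + 2 * s - X ω) / (2 * s)) ((X ω - c) / (2 * s))
      (div_nonneg (by linarith) (by linarith)) (div_nonneg (by linarith) (by linarith))
      (by field_simp; ring)
    have hX : (c + 2 * s - X ω) / (2 * s) * c + (X ω - c) / (2 * s) * (c + 2 * s) = X ω := by
      field_simp; ring
    simp only [smul_eq_mul, hX] at hconv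
    refine hconv.trans_eq ?_
    simp only [hf]
    ring
  have hscale (x : ℝ) : max 0 (s * x - t) ^ 5 = s ^ 5 * max 0 (x - t / s) ^ 5 := by
    rw [← mul_pow, mul_max_of_nonneg _ _ hs.le, mul_zero, mul_sub, mul_div_cancel₀ _ hs.ne']
  have hleft : Integrable (fun ω => (c + 2 * s - X ω) * (f c / (2 * s))) μ :=
    ((integrable_const _).sub hInt).mul_const _
  have hright : Integrable (fun ω => (X ω - c) * (f (c + 2 * s) / (2 * s))) μ :=
    (hInt.sub (integrable_const _)).mul_const _
  have h2 := twoPoint_le (a := -c / s) (div_nonneg (by linarith) hs.le)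
    (by rw [div_le_iff₀ hs]; linarith) (t / s)
  calc ∫ ω, f (X ω) ∂μ
      ≤ ∫ ω, ((c + 2 * s - X ω) * (f c / (2 * s)) + (X ω - c) * (f (c + 2 * s) / (2 * s))) ∂μ :=
        integral_mono_of_nonneg (Filter.Eventually.of_forall fun ω => by positivity)
          (hleft.add hright) hchord
    _ = (c + 2 * s) * (f c / (2 * s)) + -c * (f (c + 2 * s) / (2 * s)) := by
        rw [integral_add hleft hright, integral_mul_const, integral_mul_const,
          integral_sub (integrable_const _) hInt, integral_sub hInt (integrable_const _), hEX]
        simp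
    _ = s ^ 5 * (-c / s * max 0 (2 - -c / s - t / s) ^ 5 / 2 +
          (2 - -c / s) * max 0 (-(-c / s) - t / s) ^ 5 / 2) := by
        have hfc : f c = s ^ 5 * max 0 (-(-c / s) - t / s) ^ 5 := by
          rw [← hscale]; simp only [hf]; congr 3; field_simp
        have hfd : f (c + 2 * s) = s ^ 5 * max 0 (2 - -c / s - t / s) ^ 5 := by
          rw [← hscale]; simp only [hf]; congr 3; field_simp; ring
        rw [hfc, hfd]
        field_simp
        ring
    _ ≤ s ^ 5 * ∫ z, max 0 (z - t / s) ^ 5 ∂gaussianReal 0 1 := by gcongr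
    _ = ∫ z, max 0 (s * z - t) ^ 5 ∂gaussianReal 0 1 := by
        simp_rw [hscale, integral_const_mul]
end
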